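/- Let Z be a set of s ≥ 10 points in the complex projective plane ℙ² and let I be its radical homogeneous ideal. If α̂(I) < 5/2, then Z is contained in a conic, and consequently α̂(I) ≤ 2. -/

import Mathlib

open scoped LinearAlgebra.Projectivization

/-- A polynomial `F` vanishes to order at least `m` at the (affine representative) point
`v`: all iterated partial derivatives of order `≤ m - 1` (i.e. of order `< m`) vanish at `v`. -/
def VanishesToOrder (m : ℕ) (F : MvPolynomial (Fin 3) ℂ) (v : Fin 3 → ℂ) : Prop :=
  ∀ k : ℕ, k < m → ∀ d : Fin k → Fin 3,
    MvPolynomial.eval v ((List.ofFn d).foldl (fun p i => MvPolynomial.pderiv i p) F) = 0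

/-- The `m`-th symbolic power of the (radical) ideal of a set `Z` of points of `ℙ²`:
all polynomials vanishing to order at least `m` at every point of `Z`. -/
def symbolicPower (Z : Set (ℙ ℂ (Fin 3 → ℂ))) (m : ℕ) : Set (MvPolynomial (Fin 3) ℂ) :=
  {F | ∀ P ∈ Z, ∀ (v : Fin 3 → ℂ) (hv : v ≠ 0),
    Projectivization.mk ℂ v hv = P → VanishesToOrder m F v}

/-- The initial degree `α` of a set of polynomials: the least `t` such that the set contains
a nonzero homogeneous polynomial of degree `t`. -/
noncomputable def initialDegree (S : Set (MvPolynomial (Fin 3) ℂ)) : ℕ :=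
  sInf {t | ∃ F ∈ S, F ≠ 0 ∧ F.IsHomogeneous t}

/-- The Waldschmidt constant `α̂(I) = inf_{m ≥ 1} α(I^(m))/m` of the radical ideal of `Z`. -/
noncomputable def waldschmidt (Z : Set (ℙ ℂ (Fin 3 → ℂ))) : ℝ :=
  ⨅ m : ℕ+, (initialDegree (symbolicPower Z (m : ℕ)) : ℝ) / ((m : ℕ) : ℝ)

/-- A (homogeneous equation of a) line in `ℙ²`: a nonzero homogeneous polynomial of degree 1. -/
def IsLine (L : MvPolynomial (Fin 3) ℂ) : Prop := L ≠ 0 ∧ L.IsHomogeneous 1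

/-- The point `x ∈ ℙ²` lies on the line (or curve) with equation `L`. -/
def MemLine (L : MvPolynomial (Fin 3) ℂ) (x : ℙ ℂ (Fin 3 → ℂ)) : Prop :=
  ∀ (v : Fin 3 → ℂ) (hv : v ≠ 0), Projectivization.mk ℂ v hv = x → MvPolynomial.eval v L = 0

/-- Three points of `ℙ²` are collinear if some line contains all of them. -/
def Collin (x y z : ℙ ℂ (Fin 3 → ℂ)) : Prop :=
  ∃ M, IsLine M ∧ MemLine M x ∧ MemLine M y ∧ MemLine M z

/-- `Z` is contained in a conic: the zero set of a nonzero homogeneous polynomial of degree 2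
(possibly degenerate). -/
def ContainedInConic (Z : Set (ℙ ℂ (Fin 3 → ℂ))) : Prop :=
  ∃ F : MvPolynomial (Fin 3) ℂ, F ≠ 0 ∧ F.IsHomogeneous 2 ∧ ∀ x ∈ Z, MemLine F x

open MvPolynomial in
/-- The value of a form at a rescaled point of an arbitrary algebra. -/
theorem aeval_mul_of_isHomogeneous {A : Type*} [CommRing A] [Algebra ℂ A]
    {F : MvPolynomial (Fin 3) ℂ} {d : ℕ} (hF : F.IsHomogeneous d) (a : A) (g : Fin 3 → A) :
    aeval (fun i => a * g i) F = a ^ d * aeval g F := by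
  rw [F.as_sum, map_sum, map_sum, Finset.mul_sum]
  refine Finset.sum_congr rfl fun k hk => ?_
  have hdeg : k 0 + k 1 + k 2 = d := by
    have := hF.degree_eq_sum_deg_support hk
    rw [this, ← Finsupp.degree_apply, Finsupp.degree_eq_sum, Fin.sum_univ_three]
  rw [aeval_monomial, aeval_monomial, Finsupp.prod_fintype _ _ (by simp),
    Finsupp.prod_fintype _ _ (by simp), Fin.prod_univ_three, Fin.prod_univ_three, ← hdeg]
  ring

open MvPolynomial in
theorem eval_smul_of_isHomogeneous {F : MvPolynomial (Fin 3) ℂ} {d : ℕ}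
    (hF : F.IsHomogeneous d) (a : ℂ) (v : Fin 3 → ℂ) :
    eval (a • v) F = a ^ d * eval v F :=
  aeval_mul_of_isHomogeneous hF a v

open MvPolynomial in
/-- The expansion of `F` around `v`: the polynomial `F (v + T X)` in the variable `T`. -/
noncomputable def expansion (v : Fin 3 → ℂ) :
    MvPolynomial (Fin 3) ℂ →ₐ[ℂ] Polynomial (MvPolynomial (Fin 3) ℂ) :=
  aeval fun i => Polynomial.C (C (v i)) + Polynomial.X * Polynomial.C (X i)

open MvPolynomial in
theorem eval_one_expansion (v : Fin 3 → ℂ) (F : MvPolynomial (Fin 3) ℂ) :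
    (expansion v F).eval 1 = aeval (fun i => C (v i) + X i) F := by
  have : ((Polynomial.aeval (1 : MvPolynomial (Fin 3) ℂ)).restrictScalars ℂ).comp (expansion v)
      = aeval (fun i => C (v i) + X i) := by
    ext i; simp [expansion]
  simpa [Polynomial.aeval_def, Polynomial.eval₂_eq_eval_map] using DFunLike.congr_fun this F

open MvPolynomial in
theorem expansion_ne_zero (v : Fin 3 → ℂ) {F : MvPolynomial (Fin 3) ℂ} (hF : F ≠ 0) :
    expansion v F ≠ 0 := by
  intro h
  have h1 := eval_one_expansion v F
  rw [h, Polynomial.eval_zero] at h1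
  apply hF
  have h2 : (aeval (fun i => X i - C (v i))).comp (aeval (fun i => C (v i) + X i))
      = AlgHom.id ℂ (MvPolynomial (Fin 3) ℂ) := by
    ext i; simp
  have := DFunLike.congr_fun h2 F
  rw [AlgHom.comp_apply, ← h1, map_zero] at this
  simpa using this.symm

open MvPolynomial in
theorem coeff_zero_expansion (v : Fin 3 → ℂ) (F : MvPolynomial (Fin 3) ℂ) :
    (expansion v F).coeff 0 = C (eval v F) := by
  have : ((Polynomial.aeval (0 : MvPolynomial (Fin 3) ℂ)).restrictScalars ℂ).comp (expansion v)
      = (Algebra.ofId ℂ _).comp (aeval v) := by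
    ext i; simp [expansion, Algebra.ofId_apply]
  have := DFunLike.congr_fun this F
  simpa [Polynomial.coeff_zero_eq_eval_zero, Polynomial.aeval_def, Polynomial.eval₂_eq_eval_map,
    Algebra.ofId_apply, aeval_eq_eval] using this

open MvPolynomial in
theorem derivative_expansion (v : Fin 3 → ℂ) (F : MvPolynomial (Fin 3) ℂ) :
    (expansion v F).derivative
      = ∑ i, Polynomial.C (X i) * expansion v (pderiv i F) := by
  induction F using MvPolynomial.induction_on with
  | C a => simp [expansion, algebraMap_eq, Polynomial.algebraMap_apply]
  | add p q hp hq => simp [hp, hq, mul_add, Finset.sum_add_distrib]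
  | mul_X p j hp =>
    have hj : expansion v (X j) = Polynomial.C (C (v j)) + Polynomial.X * Polynomial.C (X j) := by
      simp [expansion]
    rw [map_mul, Polynomial.derivative_mul, hp, Finset.sum_mul]
    have : ∀ i, Polynomial.C (X i) * expansion v (pderiv i (p * X j))
      = Polynomial.C (X i) * expansion v (pderiv i p) * expansion v (X j)
        + if i = j then Polynomial.C (X i) * expansion v p else 0 := by
      intro i
      rw [Derivation.leibniz, pderiv_X]
      by_cases h : i = j
      · subst h; simp; ring
      · simp [h]; ring
    rw [Finset.sum_congr rfl fun i _ => this i, Finset.sum_add_distrib]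
    simp [hj]; ring

/-- The multiplicity of `F` at a point of the plane. -/
noncomputable def ordAt (P : ℙ ℂ (Fin 3 → ℂ)) (F : MvPolynomial (Fin 3) ℂ) : ℕ :=
  (expansion P.rep F).natTrailingDegree

theorem VanishesToOrder.pderiv {m : ℕ} {F : MvPolynomial (Fin 3) ℂ} {v : Fin 3 → ℂ}
    (h : VanishesToOrder (m + 1) F v) (i : Fin 3) :
    VanishesToOrder m (MvPolynomial.pderiv i F) v := by
  intro k hk d
  simpa [List.ofFn_cons] using h (k + 1) (by omega) (Fin.cons i d)

theorem VanishesToOrder.eval_eq_zero {m : ℕ} {F : MvPolynomial (Fin 3) ℂ} {v : Fin 3 → ℂ}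
    (h : VanishesToOrder (m + 1) F v) : MvPolynomial.eval v F = 0 := by
  simpa using h 0 (by omega) Fin.elim0

theorem vanishesToOrder_succ {m : ℕ} {F : MvPolynomial (Fin 3) ℂ} {v : Fin 3 → ℂ}
    (h0 : MvPolynomial.eval v F = 0)
    (h : ∀ i, VanishesToOrder m (MvPolynomial.pderiv i F) v) : VanishesToOrder (m + 1) F v := by
  intro k hk d
  cases k with
  | zero => simpa using h0
  | succ k => simpa [List.ofFn_succ] using h (d 0) k (by omega) fun j => d j.succ

theorem VanishesToOrder.coeff_expansion {m : ℕ} {F : MvPolynomial (Fin 3) ℂ} {v : Fin 3 → ℂ}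
    (h : VanishesToOrder m F v) : ∀ k < m, (expansion v F).coeff k = 0 := by
  induction m generalizing F with
  | zero => simp
  | succ m ih =>
    rintro (_ | k) hk
    · rw [coeff_zero_expansion, h.eval_eq_zero, map_zero]
    · have h1 := congrArg (Polynomial.coeff · k) (derivative_expansion v F)
      simp only [Polynomial.coeff_derivative, Polynomial.finsetSum_coeff,
        Polynomial.coeff_C_mul] at h1
      rw [Finset.sum_eq_zero fun i _ => by rw [ih (h.pderiv i) k (by omega), mul_zero]] at h1
      refine (mul_eq_zero.mp h1).resolve_right ?_
      exact_mod_cast Nat.succ_ne_zero k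

theorem vanishesToOrder_pow_mul {v : Fin 3 → ℂ} {G : MvPolynomial (Fin 3) ℂ}
    (hG : MvPolynomial.eval v G = 0) (m : ℕ) (H : MvPolynomial (Fin 3) ℂ) :
    VanishesToOrder m (G ^ m * H) v := by
  induction m generalizing H with
  | zero => intro k hk; omega
  | succ m ih =>
    refine vanishesToOrder_succ (by simp [hG]) fun i => ?_
    convert! ih ((m + 1) * MvPolynomial.pderiv i G * H + G * MvPolynomial.pderiv i H) using 1
    simp [Derivation.leibniz, Derivation.leibniz_pow]
    ring

theorem le_ordAt {m : ℕ} {F : MvPolynomial (Fin 3) ℂ} (hF : F ≠ 0) {P : ℙ ℂ (Fin 3 → ℂ)}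
    (h : VanishesToOrder m F P.rep) : m ≤ ordAt P F :=
  Polynomial.le_natTrailingDegree (expansion_ne_zero _ hF) h.coeff_expansion

theorem ordAt_mul (P : ℙ ℂ (Fin 3 → ℂ)) {F G : MvPolynomial (Fin 3) ℂ} (hF : F ≠ 0)
    (hG : G ≠ 0) : ordAt P (F * G) = ordAt P F + ordAt P G := by
  rw [ordAt, map_mul, Polynomial.natTrailingDegree_mul (expansion_ne_zero _ hF)
    (expansion_ne_zero _ hG), ordAt, ordAt]

theorem ordAt_eq_zero {P : ℙ ℂ (Fin 3 → ℂ)} {F : MvPolynomial (Fin 3) ℂ}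
    (h : MvPolynomial.eval P.rep F ≠ 0) : ordAt P F = 0 := by
  refine Polynomial.natTrailingDegree_eq_zero.mpr (Or.inr ?_)
  rw [coeff_zero_expansion]
  simpa using h

theorem one_le_ordAt {P : ℙ ℂ (Fin 3 → ℂ)} {F : MvPolynomial (Fin 3) ℂ} (hF : F ≠ 0)
    (h : MvPolynomial.eval P.rep F = 0) : 1 ≤ ordAt P F := by
  refine Polynomial.le_natTrailingDegree (expansion_ne_zero _ hF) fun k hk => ?_
  obtain rfl : k = 0 := by omega
  rw [coeff_zero_expansion, h, map_zero]

open MvPolynomial in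
theorem expansion_zero_of_isHomogeneous {F : MvPolynomial (Fin 3) ℂ} {d : ℕ}
    (hF : F.IsHomogeneous d) : expansion 0 F = Polynomial.C F * Polynomial.X ^ d := by
  have h1 : expansion 0 F = aeval (fun i => Polynomial.X * Polynomial.C (X i)) F := by
    simp [expansion]
  have h2 : (Polynomial.CAlgHom (R := MvPolynomial (Fin 3) ℂ)
      (A := MvPolynomial (Fin 3) ℂ)).restrictScalars ℂ
      = aeval (fun i => Polynomial.C (X i : MvPolynomial (Fin 3) ℂ)) := by
    ext i; simp
  rw [h1, aeval_mul_of_isHomogeneous hF, ← h2, mul_comm]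
  simp

open MvPolynomial in
theorem coeff_expansion_zero (F : MvPolynomial (Fin 3) ℂ) (n : ℕ) :
    ((expansion 0 F).coeff n).IsHomogeneous n := by
  rw [← sum_homogeneousComponent F, map_sum, Polynomial.finsetSum_coeff]
  refine IsHomogeneous.sum _ _ _ fun k _ => ?_
  rw [expansion_zero_of_isHomogeneous (homogeneousComponent_isHomogeneous k F),
    Polynomial.coeff_C_mul_X_pow]
  split_ifs with h
  · exact h ▸ homogeneousComponent_isHomogeneous k F
  · exact isHomogeneous_zero _ _ _

open MvPolynomial in
theorem isHomogeneous_of_natDegree_le_natTrailingDegree {F : MvPolynomial (Fin 3) ℂ}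
    (h : (expansion 0 F).natDegree ≤ (expansion 0 F).natTrailingDegree) :
    F.IsHomogeneous (expansion 0 F).natDegree := by
  have h1 := eval_one_expansion 0 F
  rw [Polynomial.eval_eq_sum_range, Finset.sum_eq_single (expansion 0 F).natDegree] at h1
  · simp only [one_pow, mul_one, Pi.zero_apply, map_zero, zero_add, aeval_X_left,
      AlgHom.coe_id, id_eq] at h1
    have h2 := coeff_expansion_zero F (expansion 0 F).natDegree
    rw [h1] at h2
    exact h2
  · intro k hk hne
    rw [Polynomial.coeff_eq_zero_of_lt_natTrailingDegree, zero_mul]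
    have := Finset.mem_range.mp hk
    omega
  · simp

/-- Factors of a nonzero form are forms. -/
theorem exists_isHomogeneous_of_mul {G H : MvPolynomial (Fin 3) ℂ} {d : ℕ}
    (hGH : (G * H).IsHomogeneous d) (h0 : G * H ≠ 0) :
    ∃ a b, a + b = d ∧ G.IsHomogeneous a ∧ H.IsHomogeneous b := by
  have hG := expansion_ne_zero 0 (left_ne_zero_of_mul h0)
  have hH := expansion_ne_zero 0 (right_ne_zero_of_mul h0)
  have hexp := expansion_zero_of_isHomogeneous hGH
  have hdeg := congrArg Polynomial.natDegree hexp
  have htrail := congrArg Polynomial.natTrailingDegree hexp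
  rw [map_mul, Polynomial.natDegree_mul hG hH, Polynomial.natDegree_C_mul_X_pow _ _ h0] at hdeg
  rw [map_mul, Polynomial.natTrailingDegree_mul hG hH, Polynomial.C_mul_X_pow_eq_monomial,
    Polynomial.natTrailingDegree_monomial h0] at htrail
  have h1 := Polynomial.natTrailingDegree_le_natDegree (expansion 0 G)
  have h2 := Polynomial.natTrailingDegree_le_natDegree (expansion 0 H)
  exact ⟨_, _, hdeg, isHomogeneous_of_natDegree_le_natTrailingDegree (by omega),
    isHomogeneous_of_natDegree_le_natTrailingDegree (by omega)⟩

open MvPolynomial in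
theorem exists_eval_ne_zero_of_not_dvd {C F : MvPolynomial (Fin 3) ℂ} (hC : Irreducible C)
    (h : ¬ C ∣ F) : ∃ v, eval v C = 0 ∧ eval v F ≠ 0 := by
  by_contra! hcon
  apply h
  have hp : (Ideal.span {C}).IsPrime :=
    (Ideal.span_singleton_prime hC.ne_zero).mpr hC.prime
  rw [← Ideal.mem_span_singleton, ← IsPrime.vanishingIdeal_zeroLocus (K := ℂ) (Ideal.span {C}),
    mem_vanishingIdeal_iff]
  intro v hv
  rw [aeval_eq_eval]
  refine hcon v ?_
  simpa [aeval_eq_eval] using hv C (Ideal.mem_span_singleton_self C)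

open Polynomial in
theorem coeff_mul_pow_three {p q r : ℂ[X]} {e : ℕ} (hp : p.natDegree ≤ e) (hq : q.natDegree ≤ e)
    (hr : r.natDegree ≤ e) (i j k : ℕ) :
    (p ^ i * q ^ j * r ^ k).natDegree ≤ e * (i + j + k) ∧
      (p ^ i * q ^ j * r ^ k).coeff (e * (i + j + k))
        = p.coeff e ^ i * q.coeff e ^ j * r.coeff e ^ k := by
  have h1 : (p ^ i).natDegree ≤ i * e := natDegree_pow_le_of_le _ hp
  have h2 : (q ^ j).natDegree ≤ j * e := natDegree_pow_le_of_le _ hq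
  have h3 : (r ^ k).natDegree ≤ k * e := natDegree_pow_le_of_le _ hr
  have h12 := natDegree_mul_le_of_le h1 h2
  have he : e * (i + j + k) = i * e + j * e + k * e := by ring
  rw [he]
  refine ⟨natDegree_mul_le_of_le h12 h3, ?_⟩
  rw [coeff_mul_add_eq_of_natDegree_le h12 h3, coeff_mul_add_eq_of_natDegree_le h1 h2,
    coeff_pow_of_natDegree_le hp, coeff_pow_of_natDegree_le hq, coeff_pow_of_natDegree_le hr]

open Polynomial in
/-- Degree and leading coefficient of the restriction of a form to a parametrized curve. -/
theorem natDegree_aeval_le_and_coeff {F : MvPolynomial (Fin 3) ℂ} {d e : ℕ}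
    (hF : F.IsHomogeneous d) {γ : Fin 3 → ℂ[X]} (hγ : ∀ i, (γ i).natDegree ≤ e) :
    (MvPolynomial.aeval γ F).natDegree ≤ e * d ∧
      (MvPolynomial.aeval γ F).coeff (e * d) = MvPolynomial.eval (fun i => (γ i).coeff e) F := by
  have key : ∀ k ∈ F.support,
      (MvPolynomial.aeval γ (MvPolynomial.monomial k (F.coeff k))).natDegree ≤ e * d ∧
      (MvPolynomial.aeval γ (MvPolynomial.monomial k (F.coeff k))).coeff (e * d)
        = MvPolynomial.eval (fun i => (γ i).coeff e)
          (MvPolynomial.monomial k (F.coeff k)) := by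
    intro k hk
    have hdeg : k 0 + k 1 + k 2 = d := by
      have := hF.degree_eq_sum_deg_support hk
      rw [this, ← Finsupp.degree_apply, Finsupp.degree_eq_sum, Fin.sum_univ_three]
    obtain ⟨h1, h2⟩ := coeff_mul_pow_three (hγ 0) (hγ 1) (hγ 2) (k 0) (k 1) (k 2)
    rw [hdeg] at h1 h2
    rw [MvPolynomial.aeval_monomial, MvPolynomial.eval_monomial,
      Finsupp.prod_fintype _ _ (by simp), Finsupp.prod_fintype _ _ (by simp),
      Fin.prod_univ_three, Fin.prod_univ_three, ← h2, algebraMap_eq]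
    exact ⟨natDegree_C_mul_le _ _ |>.trans h1, coeff_C_mul _⟩
  constructor
  · rw [F.as_sum, map_sum]
    exact natDegree_sum_le_of_forall_le _ _ fun k hk => (key k hk).1
  · conv_lhs => rw [F.as_sum]
    conv_rhs => rw [F.as_sum]
    rw [map_sum, map_sum, finsetSum_coeff]
    exact Finset.sum_congr rfl fun k hk => (key k hk).2

open Polynomial in
theorem pow_ordAt_dvd_aeval {F : MvPolynomial (Fin 3) ℂ} {d : ℕ} (hF : F.IsHomogeneous d)
    {γ : Fin 3 → ℂ[X]} {P : ℙ ℂ (Fin 3 → ℂ)} {τ c : ℂ} (hc : c ≠ 0)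
    (h : ∀ i, (γ i).eval τ = c * P.rep i) :
    (X - C τ) ^ ordAt P F ∣ MvPolynomial.aeval γ F := by
  choose δ hδ using fun i => X_sub_C_dvd_sub_C_eval (p := γ i) (a := τ)
  have hγ : γ = fun i => C c * (C (P.rep i) + (X - C τ) * (C c⁻¹ * δ i)) := by
    funext i
    have h1 := hδ i
    have h2 : C c * C c⁻¹ = (1 : ℂ[X]) := by rw [← C_mul, mul_inv_cancel₀ hc, C_1]
    rw [h i, C_mul] at h1
    linear_combination h1 - (X - C τ) * δ i * h2
  rw [hγ, aeval_mul_of_isHomogeneous hF]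
  refine Dvd.dvd.mul_left ?_ _
  obtain ⟨q, hq⟩ : (X : (MvPolynomial (Fin 3) ℂ)[X]) ^ ordAt P F ∣ expansion P.rep F :=
    X_pow_dvd_iff.mpr fun k hk => coeff_eq_zero_of_lt_natTrailingDegree hk
  let ψ : (MvPolynomial (Fin 3) ℂ)[X] →+* ℂ[X] :=
    eval₂RingHom (MvPolynomial.aeval fun i => C c⁻¹ * δ i : _ →ₐ[ℂ] ℂ[X]).toRingHom (X - C τ)
  have hψ : ∀ G, ψ (expansion P.rep G)
      = MvPolynomial.aeval (fun i => C (P.rep i) + (X - C τ) * (C c⁻¹ * δ i)) G := by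
    intro G
    induction G using MvPolynomial.induction_on with
    | C a => simp [ψ, expansion, Polynomial.algebraMap_apply, MvPolynomial.algebraMap_eq]
    | add p q hp hq => simp only [map_add, hp, hq]
    | mul_X p j hp =>
      rw [map_mul, map_mul, hp, map_mul]
      simp [ψ, expansion]
      exact Or.inl (mul_comm _ _)
  have hX : ψ X = X - C τ := by simp [ψ]
  rw [← hψ, hq, map_mul, map_pow, hX]
  exact dvd_mul_right _ _

theorem Projectivization.eq_of_rep_eq_smul {P Q : ℙ ℂ (Fin 3 → ℂ)} {c : ℂ}
    (h : P.rep = c • Q.rep) : P = Q := by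
  rw [← P.mk_rep, ← Q.mk_rep, Projectivization.mk_eq_mk_iff']
  exact ⟨c, h.symm⟩

open Polynomial in
/-- A form cannot vanish too often along a parametrized rational curve. -/
theorem sum_ordAt_le_of_param {F : MvPolynomial (Fin 3) ℂ} {d e : ℕ}
    (hF : F.IsHomogeneous d) {γ : Fin 3 → ℂ[X]} (hγ : ∀ i, (γ i).natDegree ≤ e)
    (hlead : MvPolynomial.eval (fun i => (γ i).coeff e) F ≠ 0) (S : Finset (ℙ ℂ (Fin 3 → ℂ)))
    (hS : ∀ P ∈ S, ∃ τ c : ℂ, c ≠ 0 ∧ ∀ i, (γ i).eval τ = c * P.rep i) :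
    ∑ P ∈ S, ordAt P F ≤ e * d := by
  obtain ⟨hdeg, hcoeff⟩ := natDegree_aeval_le_and_coeff hF hγ
  have hne : MvPolynomial.aeval γ F ≠ 0 := by
    intro h0
    rw [h0, coeff_zero] at hcoeff
    exact hlead hcoeff.symm
  choose! τ c hc hτ using hS
  have hdvd : ∏ P ∈ S, (X - C (τ P)) ^ ordAt P F ∣ MvPolynomial.aeval γ F := by
    refine Finset.prod_dvd_of_coprime (fun P hP Q hQ hPQ => ?_) fun P hP =>
      pow_ordAt_dvd_aeval hF (hc P hP) (hτ P hP)
    refine (isCoprime_X_sub_C_of_isUnit_sub ?_).pow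
    rw [isUnit_iff_ne_zero, sub_ne_zero]
    intro heq
    apply hPQ
    refine Projectivization.eq_of_rep_eq_smul (c := (c P)⁻¹ * c Q) ?_
    funext i
    have h1 := hτ P hP i
    have h2 := hτ Q hQ i
    rw [heq, h2] at h1
    rw [Pi.smul_apply, smul_eq_mul, mul_assoc, h1, inv_mul_cancel_left₀ (hc P hP)]
  have := natDegree_le_of_dvd hdvd hne
  rw [natDegree_prod_of_monic _ _ fun P _ => (monic_X_sub_C _).pow _] at this
  simpa using this.trans hdeg

/-- An irreducible curve of degree `e` along which the Bézout inequality holds. -/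
structure IsTestCurve (C : MvPolynomial (Fin 3) ℂ) (e : ℕ) : Prop where
  ne_zero : C ≠ 0
  isHomogeneous : C.IsHomogeneous e
  pos : 0 < e
  bezout : ∀ (F : MvPolynomial (Fin 3) ℂ) (d : ℕ), F.IsHomogeneous d → ¬ C ∣ F →
    ∀ S : Finset (ℙ ℂ (Fin 3 → ℂ)), (∀ P ∈ S, MvPolynomial.eval P.rep C = 0) →
      ∑ P ∈ S, ordAt P F ≤ e * d

/-- In the Bézout inequality one only needs to look at the zeros of the form. -/
theorem sum_ordAt_le_of_nonempty {F : MvPolynomial (Fin 3) ℂ} {n : ℕ}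
    {S : Finset (ℙ ℂ (Fin 3 → ℂ))}
    (h : ∀ P₁ ∈ S, MvPolynomial.eval P₁.rep F = 0 → ∀ T ⊆ S,
      (∀ P ∈ T, MvPolynomial.eval P.rep F = 0) → ∑ P ∈ T, ordAt P F ≤ n) :
    ∑ P ∈ S, ordAt P F ≤ n := by
  classical
  have hfilter : ∀ P ∈ S, ordAt P F ≠ 0 → MvPolynomial.eval P.rep F = 0 :=
    fun P _ hP => by_contra fun hne => hP (ordAt_eq_zero hne)
  rw [← Finset.sum_filter_of_ne hfilter]
  rcases (S.filter fun P => MvPolynomial.eval P.rep F = 0).eq_empty_or_nonempty with he | ⟨P, hP⟩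
  · rw [he]; simp
  · obtain ⟨h1, h2⟩ := Finset.mem_filter.mp hP
    exact h P h1 h2 _ (Finset.filter_subset _ _) fun Q hQ => (Finset.mem_filter.mp hQ).2

theorem irreducible_of_isLine {L : MvPolynomial (Fin 3) ℂ} (hL : IsLine L) : Irreducible L := by
  refine MvPolynomial.irreducible_of_totalDegree_eq_one (hL.2.totalDegree hL.1) fun x hx => ?_
  rw [isUnit_iff_ne_zero]
  rintro rfl
  apply hL.1
  ext k
  simpa using hx k

open MvPolynomial in
/-- The linear form with given coefficients. -/
noncomputable def linForm (a : Fin 3 → ℂ) : MvPolynomial (Fin 3) ℂ := ∑ i, C (a i) * X i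

open MvPolynomial in
theorem eval_linForm (a v : Fin 3 → ℂ) : eval v (linForm a) = ∑ i, a i * v i := by
  simp [linForm]

open MvPolynomial in
theorem isLine_linForm {a : Fin 3 → ℂ} (ha : a ≠ 0) : IsLine (linForm a) := by
  refine ⟨fun h => ha ?_, IsHomogeneous.sum _ _ _ fun i _ => isHomogeneous_C_mul_X _ _⟩
  funext j
  have := eval_linForm a (Pi.single j 1)
  rw [h] at this
  simpa [Pi.single_apply] using this.symm

open MvPolynomial in
theorem exists_linForm {L : MvPolynomial (Fin 3) ℂ} (hL : L.IsHomogeneous 1) :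
    ∃ a, L = linForm a := by
  rw [← mem_homogeneousSubmodule, homogeneousSubmodule_one_eq_span_X,
    Submodule.mem_span_range_iff_exists_fun] at hL
  obtain ⟨a, rfl⟩ := hL
  exact ⟨a, by simp [linForm, smul_eq_C_mul]⟩

/-- Three points on a line are linearly dependent. -/
theorem exists_dependence {L : MvPolynomial (Fin 3) ℂ} (hL : IsLine L) {u v w : Fin 3 → ℂ}
    (hu : MvPolynomial.eval u L = 0) (hv : MvPolynomial.eval v L = 0)
    (hw : MvPolynomial.eval w L = 0) :
    ∃ x y z : ℂ, (x ≠ 0 ∨ y ≠ 0 ∨ z ≠ 0) ∧ x • u + y • v + z • w = 0 := by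
  obtain ⟨a, rfl⟩ := exists_linForm hL.2
  have ha : a ≠ 0 := by
    rintro rfl
    exact hL.1 (by simp [linForm])
  rw [eval_linForm, Fin.sum_univ_three] at hu hv hw
  have hdet : (Matrix.of ![u, v, w]).det = 0 := by
    refine Matrix.exists_mulVec_eq_zero_iff.mp ⟨a, ha, ?_⟩
    funext i
    fin_cases i
    · simpa [Matrix.mulVec, dotProduct, Fin.sum_univ_three, mul_comm] using hu
    · simpa [Matrix.mulVec, dotProduct, Fin.sum_univ_three, mul_comm] using hv
    · simpa [Matrix.mulVec, dotProduct, Fin.sum_univ_three, mul_comm] using hw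
  obtain ⟨c, hc, hc0⟩ := Matrix.exists_vecMul_eq_zero_iff.mpr hdet
  refine ⟨c 0, c 1, c 2, ?_, ?_⟩
  · by_contra! h
    exact hc (by funext i; fin_cases i <;> simp [h])
  · funext i
    simpa [Matrix.vecMul, dotProduct, Fin.sum_univ_three] using congrFun hc0 i

/-- A zero of a form is not proportional to a nonzero value. -/
theorem not_smul_of_eval {F : MvPolynomial (Fin 3) ℂ} {d : ℕ} (hF : F.IsHomogeneous d)
    {u v : Fin 3 → ℂ} (hu : MvPolynomial.eval u F ≠ 0) (hv : MvPolynomial.eval v F = 0) (c : ℂ) :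
    u ≠ c • v := by
  rintro rfl
  rw [eval_smul_of_isHomogeneous hF, hv, mul_zero] at hu
  exact hu rfl

/-- If `u` is not a multiple of `v`, then a point dependent with them is a combination. -/
theorem exists_combination {u v w : Fin 3 → ℂ} {x y z : ℂ} (hxyz : x ≠ 0 ∨ y ≠ 0 ∨ z ≠ 0)
    (h : x • u + y • v + z • w = 0) (hv : v ≠ 0) (huv : ∀ c : ℂ, u ≠ c • v) :
    ∃ a b : ℂ, w = a • u + b • v := by
  have hz : z ≠ 0 := by
    rintro rfl
    rw [zero_smul, add_zero] at h
    by_cases hx : x = 0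
    · subst hx
      simp only [zero_smul, zero_add, smul_eq_zero, hv, or_false] at h
      simp [h] at hxyz
    · refine huv (-(x⁻¹ * y)) ?_
      have h1 : x⁻¹ • (x • u + y • v) = 0 := by rw [h, smul_zero]
      rw [smul_add, inv_smul_smul₀ hx] at h1
      rw [neg_smul, mul_smul]
      exact eq_neg_of_add_eq_zero_left h1
  refine ⟨-(z⁻¹ * x), -(z⁻¹ * y), ?_⟩
  funext i
  have := congrFun h i
  simp only [Pi.add_apply, Pi.smul_apply, smul_eq_mul, Pi.zero_apply] at this ⊢
  field_simp
  linear_combination this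

open Polynomial in
theorem isTestCurve_of_isLine {L : MvPolynomial (Fin 3) ℂ} (hL : IsLine L) : IsTestCurve L 1 where
  ne_zero := hL.1
  isHomogeneous := hL.2
  pos := one_pos
  bezout F d hF hdvd S hS := by
    obtain ⟨v, hv, hFv⟩ := exists_eval_ne_zero_of_not_dvd (irreducible_of_isLine hL) hdvd
    refine sum_ordAt_le_of_nonempty fun P₁ hP₁ hFP₁ T hT hFT => ?_
    refine sum_ordAt_le_of_param hF (γ := fun i => C (v i) * X + C (P₁.rep i))
      (fun i => natDegree_linear_le) (by simpa using hFv) T fun P hP => ?_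
    obtain ⟨x, y, z, hne, h⟩ := exists_dependence hL hv (hS _ hP₁) (hS _ (hT hP))
    obtain ⟨a, b, hab⟩ := exists_combination hne h P₁.rep_nonzero (not_smul_of_eval hF hFv hFP₁)
    have hb : b ≠ 0 := by
      rintro rfl
      rw [zero_smul, add_zero] at hab
      have ha : a ≠ 0 := by
        rintro rfl
        exact P.rep_nonzero (by rw [hab, zero_smul])
      exact not_smul_of_eval hF hFv (hFT P hP) a⁻¹ (by rw [hab, inv_smul_smul₀ ha])
    refine ⟨a / b, b⁻¹, inv_ne_zero hb, fun i => ?_⟩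
    rw [hab]
    simp
    field_simp

theorem ordAt_le_one_of_isLine {L : MvPolynomial (Fin 3) ℂ} (hL : IsLine L)
    (P : ℙ ℂ (Fin 3 → ℂ)) : ordAt P L ≤ 1 := by
  obtain ⟨v, hv⟩ : ∃ v, MvPolynomial.eval v L ≠ 0 := by
    by_contra! h
    exact hL.1 (hL.2.eq_zero_of_forall_eval_eq_zero h)
  simpa using sum_ordAt_le_of_param hL.2
    (γ := fun i => Polynomial.C (v i) * Polynomial.X + Polynomial.C (P.rep i))
    (fun i => Polynomial.natDegree_linear_le) (by simpa using hv) {P}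
    (by simp only [Finset.mem_singleton]; rintro _ rfl; exact ⟨0, 1, one_ne_zero, by simp⟩)

theorem not_isLine_dvd_conic {L Q : MvPolynomial (Fin 3) ℂ} (hL : IsLine L) (hQ : Irreducible Q)
    (hQ2 : Q.IsHomogeneous 2) : ¬ L ∣ Q := by
  intro h
  obtain ⟨R, hR⟩ := (irreducible_of_isLine hL).dvd_symm hQ h
  have hR0 : R ≠ 0 := by
    rintro rfl
    exact hL.1 (by rw [hR, mul_zero])
  have h1 := congrArg MvPolynomial.totalDegree hR
  rw [MvPolynomial.totalDegree_mul_of_isDomain hQ.ne_zero hR0, hL.2.totalDegree hL.1,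
    hQ2.totalDegree hQ.ne_zero] at h1
  omega

open MvPolynomial in
/-- A quadratic form comes from a bilinear form. -/
theorem exists_bilinForm {Q : MvPolynomial (Fin 3) ℂ} (hQ : Q.IsHomogeneous 2) :
    ∃ B : LinearMap.BilinForm ℂ (Fin 3 → ℂ), ∀ v, eval v Q = B v v := by
  rw [← mem_homogeneousSubmodule, ← homogeneousSubmodule_one_pow, pow_two] at hQ
  induction hQ using Submodule.mul_induction_on' with
  | mem_mul_mem L hL M hM =>
    obtain ⟨a, rfl⟩ := exists_linForm hL
    obtain ⟨b, rfl⟩ := exists_linForm hM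
    let f (c : Fin 3 → ℂ) : (Fin 3 → ℂ) →ₗ[ℂ] ℂ := ∑ i, c i • LinearMap.proj i
    refine ⟨LinearMap.BilinForm.linMulLin (f a) (f b), fun v => ?_⟩
    simp [eval_linForm, f]
  | add x _ y _ hx hy =>
    obtain ⟨B, hB⟩ := hx
    obtain ⟨B', hB'⟩ := hy
    exact ⟨B + B', fun v => by simp [hB, hB']⟩

/-- The line through two distinct points. -/
theorem exists_line_through {u v : Fin 3 → ℂ} (hv : v ≠ 0) (huv : ∀ c : ℂ, u ≠ c • v) :
    ∃ L, IsLine L ∧ MvPolynomial.eval u L = 0 ∧ MvPolynomial.eval v L = 0 := by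
  have hne : crossProduct u v ≠ 0 := by
    rw [crossProduct_ne_zero_iff_linearIndependent, LinearIndependent.pair_symm_iff,
      LinearIndependent.pair_iff' hv]
    exact fun c h => huv c h.symm
  refine ⟨linForm (crossProduct u v), isLine_linForm hne, ?_, ?_⟩ <;>
  · rw [eval_linForm, Fin.sum_univ_three, cross_apply]
    simp
    ring

/-- An irreducible conic contains no line. -/
theorem polar_ne_zero {Q : MvPolynomial (Fin 3) ℂ} (hQ : Irreducible Q)
    (hQ2 : Q.IsHomogeneous 2) {B : LinearMap.BilinForm ℂ (Fin 3 → ℂ)}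
    (hB : ∀ v, MvPolynomial.eval v Q = B v v) {u v : Fin 3 → ℂ} (hv : v ≠ 0)
    (huv : ∀ c : ℂ, u ≠ c • v) (hQu : B u u = 0) (hQv : B v v = 0) : B u v + B v u ≠ 0 := by
  intro h
  obtain ⟨L, hL, hLu, hLv⟩ := exists_line_through hv huv
  obtain ⟨x, hLx, hQx⟩ := exists_eval_ne_zero_of_not_dvd (irreducible_of_isLine hL)
    (not_isLine_dvd_conic hL hQ hQ2)
  obtain ⟨a, b, c, hne, habc⟩ := exists_dependence hL hLu hLv hLx
  obtain ⟨s, t, rfl⟩ := exists_combination hne habc hv huv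
  apply hQx
  rw [hB]
  simp only [map_add, map_smul, LinearMap.add_apply, LinearMap.smul_apply, smul_eq_mul]
  linear_combination s ^ 2 * hQu + t ^ 2 * hQv + s * t * h

theorem exists_combination_three {u v w : Fin 3 → ℂ} (hv : v ≠ 0) (huv : ∀ c : ℂ, u ≠ c • v)
    (hw : ∀ a b : ℂ, w ≠ a • u + b • v) (x : Fin 3 → ℂ) :
    ∃ a b c : ℂ, x = a • u + b • v + c • w := by
  have hli : LinearIndependent ℂ ![w, u, v] := by
    refine linearIndependent_finCons.mpr ⟨?_, fun h => ?_⟩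
    · change LinearIndependent ℂ ![u, v]
      rw [LinearIndependent.pair_symm_iff, LinearIndependent.pair_iff' hv]
      exact fun c h => huv c h.symm
    rw [Matrix.range_cons_cons_empty, Submodule.mem_span_pair] at h
    obtain ⟨a, b, h⟩ := h
    exact hw a b h.symm
  have hspan := hli.span_eq_top_of_card_eq_finrank (by simp)
  have hx : x ∈ Submodule.span ℂ (Set.range ![w, u, v]) := hspan ▸ Submodule.mem_top
  obtain ⟨c, hc⟩ := (Submodule.mem_span_range_iff_exists_fun ℂ).mp hx
  rw [Fin.sum_univ_three] at hc
  exact ⟨c 1, c 2, c 0, by rw [← hc]; simp; abel⟩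

theorem exists_ne_combination (u v : Fin 3 → ℂ) : ∃ w, ∀ a b : ℂ, w ≠ a • u + b • v := by
  by_contra! h
  have htop : Submodule.span ℂ (Set.range ![u, v]) = ⊤ := by
    rw [eq_top_iff]
    intro x _
    obtain ⟨a, b, rfl⟩ := h x
    rw [Matrix.range_cons_cons_empty, Submodule.mem_span_pair]
    exact ⟨a, b, rfl⟩
  have := finrank_range_le_card (R := ℂ) ![u, v]
  rw [Set.finrank, htop, finrank_top] at this
  simp at this

open Polynomial in
theorem isTestCurve_of_conic {Q : MvPolynomial (Fin 3) ℂ} (hQ : Irreducible Q)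
    (hQ2 : Q.IsHomogeneous 2) : IsTestCurve Q 2 where
  ne_zero := hQ.ne_zero
  isHomogeneous := hQ2
  pos := two_pos
  bezout F d hF hdvd S hS := by
    obtain ⟨B, hB⟩ := exists_bilinForm hQ2
    obtain ⟨v, hv, hFv⟩ := exists_eval_ne_zero_of_not_dvd hQ hdvd
    refine sum_ordAt_le_of_nonempty fun P₁ hP₁ hFP₁ T hT hFT => ?_
    set p := P₁.rep with hp
    have hp0 : p ≠ 0 := P₁.rep_nonzero
    have hvp : ∀ c : ℂ, v ≠ c • p := not_smul_of_eval hF hFv hFP₁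
    have hBv : B v v = 0 := by rw [← hB, hv]
    have hBp : B p p = 0 := by rw [← hB, hS P₁ hP₁]
    have hβ := polar_ne_zero hQ hQ2 hB hp0 hvp hBv hBp
    set β := B v p + B p v with hβdef
    obtain ⟨w, hw, hBw⟩ : ∃ w, (∀ a b : ℂ, w ≠ a • v + b • p) ∧ B v w + B w v = 0 := by
      obtain ⟨y, hy⟩ := exists_ne_combination v p
      refine ⟨y - ((B v y + B y v) / β) • p, fun a b h => ?_, ?_⟩
      · refine hy a (b + (B v y + B y v) / β) ?_
        rw [add_smul, ← add_assoc, ← h, sub_add_cancel]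
      · simp only [map_sub, map_smul, LinearMap.sub_apply, LinearMap.smul_apply, smul_eq_mul]
        field_simp
        rw [hβdef]
        ring
    have hv0 : v ≠ 0 := fun h => hvp 0 (by rw [h, zero_smul])
    have hqw : B w w ≠ 0 := by
      intro h
      refine polar_ne_zero hQ hQ2 hB hv0 (fun c hc => hw c 0 ?_) h hBv (by rw [add_comm]; exact hBw)
      rw [hc, zero_smul, add_zero]
    refine sum_ordAt_le_of_param hF
      (γ := fun i => C (B w w * v i) * X ^ 2 + C ((B w p + B p w) * v i - β * w i) * X
        + C (-(β * p i))) (fun i => natDegree_quadratic_le) ?_ T fun P hP => ?_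
    · have : (fun i => (C (B w w * v i) * X ^ 2 + C ((B w p + B p w) * v i - β * w i) * X
        + C (-(β * p i))).coeff 2) = B w w • v := by
        funext i
        simp [-map_mul]
      rw [this, eval_smul_of_isHomogeneous hF]
      exact mul_ne_zero (pow_ne_zero _ hqw) hFv
    · obtain ⟨x, y, z, hxyz⟩ := exists_combination_three hp0 hvp hw P.rep
      have hBP : B P.rep P.rep = 0 := by rw [← hB, hS P (hT hP)]
      have hvP : ∀ c : ℂ, v ≠ c • P.rep := not_smul_of_eval hF hFv (hFT P hP)
      have hpol := polar_ne_zero hQ hQ2 hB P.rep_nonzero hvP hBv hBP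
      rw [hxyz] at hpol hBP
      simp only [map_add, map_smul, LinearMap.add_apply, LinearMap.smul_apply,
        smul_eq_mul] at hpol hBP
      have hy : y ≠ 0 := by
        rintro rfl
        apply hpol
        linear_combination 2 * x * hBv + z * hBw
      have hrel : x * y * β + z ^ 2 * B w w + y * z * (B w p + B p w) = 0 := by
        rw [hβdef]
        linear_combination hBP - x ^ 2 * hBv - y ^ 2 * hBp - x * z * hBw
      refine ⟨z / y, -(β / y), neg_ne_zero.mpr (div_ne_zero hβ hy), fun i => ?_⟩
      rw [hxyz]
      simp only [eval_add, eval_mul, eval_C, eval_pow, eval_X, Pi.add_apply, Pi.smul_apply,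
        smul_eq_mul]
      field_simp
      linear_combination v i * hrel

theorem ordAt_le_one_of_conic {Q : MvPolynomial (Fin 3) ℂ} (hQ : Irreducible Q)
    (hQ2 : Q.IsHomogeneous 2) {P P' : ℙ ℂ (Fin 3 → ℂ)} (hne : P ≠ P')
    (hP' : MvPolynomial.eval P'.rep Q = 0) : ordAt P Q ≤ 1 := by
  classical
  obtain ⟨L, hL, hP, hLP'⟩ := exists_line_through P'.rep_nonzero
    fun c h => hne (Projectivization.eq_of_rep_eq_smul h)
  have h1 := (isTestCurve_of_isLine hL).bezout Q 2 hQ2 (not_isLine_dvd_conic hL hQ hQ2) {P, P'}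
    (by simp [hP, hLP'])
  rw [Finset.sum_pair hne] at h1
  have h2 := one_le_ordAt hQ.ne_zero hP'
  omega

/-- A configuration of test curves and points bounds the vanishing of every form. -/
theorem sum_ordAt_le_of_testCurves {ι : Type*} [Fintype ι] {C : ι → MvPolynomial (Fin 3) ℂ}
    {e : ι → ℕ} {S : ι → Finset (ℙ ℂ (Fin 3 → ℂ))} {δ : ℕ} (hC : ∀ i, IsTestCurve (C i) (e i))
    (hS : ∀ i, ∀ P ∈ S i, MvPolynomial.eval P.rep (C i) = 0) (hδ : ∑ i, e i = δ)
    (hcap : ∀ i, ∑ j, ∑ P ∈ S j, ordAt P (C i) ≤ δ * e i) (d : ℕ) :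
    ∀ F : MvPolynomial (Fin 3) ℂ, F.IsHomogeneous d → F ≠ 0 →
      ∑ j, ∑ P ∈ S j, ordAt P F ≤ δ * d := by
  induction d using Nat.strong_induction_on with
  | _ d ih =>
    intro F hF hF0
    by_cases hdvd : ∃ i, C i ∣ F
    · obtain ⟨i, G, rfl⟩ := hdvd
      obtain ⟨a, b, hab, ha, hb⟩ := exists_isHomogeneous_of_mul hF hF0
      have hae : a = e i := ha.inj_right (hC i).isHomogeneous (hC i).ne_zero
      have hG0 : G ≠ 0 := right_ne_zero_of_mul hF0
      have hpos := (hC i).pos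
      have h1 := ih b (by omega) G hb hG0
      have h2 := hcap i
      simp only [ordAt_mul _ (hC i).ne_zero hG0, Finset.sum_add_distrib]
      subst hae
      rw [← hab, mul_add]
      exact add_le_add h2 h1
    · rw [← hδ, Finset.sum_mul]
      exact Finset.sum_le_sum fun i _ =>
        (hC i).bezout F d hF (fun h => hdvd ⟨i, h⟩) (S i) (hS i)

/-- The data of a form of small degree vanishing to high order along `Z`. -/
structure IsSmallForm (Z : Finset (ℙ ℂ (Fin 3 → ℂ))) (F : MvPolynomial (Fin 3) ℂ) (d m : ℕ) :
    Prop where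
  ne_zero : F ≠ 0
  isHomogeneous : F.IsHomogeneous d
  le_ordAt : ∀ P ∈ Z, m ≤ ordAt P F
  lt : 2 * d < 5 * m

theorem IsSmallForm.false_of_testCurves {Z : Finset (ℙ ℂ (Fin 3 → ℂ))}
    {F : MvPolynomial (Fin 3) ℂ} {d m : ℕ} (hF : IsSmallForm Z F d m)
    {ι : Type*} [Fintype ι] {C : ι → MvPolynomial (Fin 3) ℂ}
    {e : ι → ℕ} {S : ι → Finset (ℙ ℂ (Fin 3 → ℂ))} (hC : ∀ i, IsTestCurve (C i) (e i))
    (hS : ∀ i, ∀ P ∈ S i, P ∈ Z ∧ MvPolynomial.eval P.rep (C i) = 0) (hδ : ∑ i, e i = 4)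
    (hcard : 10 ≤ ∑ i, (S i).card)
    (hcap : ∀ i, ∑ j, ∑ P ∈ S j, ordAt P (C i) ≤ 4 * e i) : False := by
  have h1 := sum_ordAt_le_of_testCurves hC (fun i P hP => (hS i P hP).2) hδ hcap d F
    hF.isHomogeneous hF.ne_zero
  have h2 : (∑ i, (S i).card) * m ≤ ∑ j, ∑ P ∈ S j, ordAt P F := by
    rw [Finset.sum_mul]
    exact Finset.sum_le_sum fun i _ => by
      simpa using Finset.card_nsmul_le_sum (S i) _ m fun P hP => hF.le_ordAt P (hS i P hP).1
  have h3 := hF.lt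
  have h4 : 10 * m ≤ (∑ i, (S i).card) * m := Nat.mul_le_mul_right _ hcard
  omega

/-- The point `P` lies on the curve with equation `C`. -/
def OnCurve (C : MvPolynomial (Fin 3) ℂ) (P : ℙ ℂ (Fin 3 → ℂ)) : Prop :=
  MvPolynomial.eval P.rep C = 0

theorem exists_isLine_onCurve {P Q : ℙ ℂ (Fin 3 → ℂ)} (h : P ≠ Q) :
    ∃ L, IsLine L ∧ OnCurve L P ∧ OnCurve L Q :=
  exists_line_through Q.rep_nonzero fun _ hc => h (Projectivization.eq_of_rep_eq_smul hc)

/-- Two lines sharing two distinct points have the same points. -/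
theorem onCurve_of_two_common {L M : MvPolynomial (Fin 3) ℂ} (hL : IsLine L) (hM : IsLine M)
    {P Q R : ℙ ℂ (Fin 3 → ℂ)} (h : P ≠ Q) (hLP : OnCurve L P) (hLQ : OnCurve L Q)
    (hMP : OnCurve M P) (hMQ : OnCurve M Q) (hR : OnCurve L R) : OnCurve M R := by
  obtain ⟨x, y, z, hne, hxyz⟩ := exists_dependence hL hLP hLQ hR
  obtain ⟨a, b, hab⟩ := exists_combination hne hxyz Q.rep_nonzero
    fun c hc => h (Projectivization.eq_of_rep_eq_smul hc)
  obtain ⟨m, rfl⟩ := exists_linForm hM.2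
  simp only [OnCurve, eval_linForm, Fin.sum_univ_three] at hMP hMQ ⊢
  rw [hab]
  simp only [Pi.add_apply, Pi.smul_apply, smul_eq_mul]
  linear_combination a * hMP + b * hMQ

open Classical in
theorem sum_ordAt_le_card {C : MvPolynomial (Fin 3) ℂ} {T : Finset (ℙ ℂ (Fin 3 → ℂ))}
    (h : ∀ P ∈ T, ordAt P C ≤ 1) : ∑ P ∈ T, ordAt P C ≤ (T.filter (OnCurve C)).card := by
  rw [Finset.card_filter]
  refine Finset.sum_le_sum fun P hP => ?_
  split_ifs with hC
  · exact h P hP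
  · exact (ordAt_eq_zero hC).le

open Classical in
theorem card_inter_le_one {L M : MvPolynomial (Fin 3) ℂ} (hL : IsLine L) (hM : IsLine M)
    {R : ℙ ℂ (Fin 3 → ℂ)} (hMR : OnCurve M R) (hLR : ¬ OnCurve L R)
    {T : Finset (ℙ ℂ (Fin 3 → ℂ))} (hT : ∀ P ∈ T, OnCurve L P) :
    (T.filter (OnCurve M)).card ≤ 1 := by
  rw [Finset.card_le_one]
  intro P hP Q hQ
  rw [Finset.mem_filter] at hP hQ
  by_contra hne
  exact hLR (onCurve_of_two_common hM hL hne hP.2 hQ.2 (hT P hP.1) (hT Q hQ.1) hMR)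

/-- A line with many points of `Z`, together with three further lines whose total weight on the
remaining points is controlled, excludes small forms. -/
theorem IsSmallForm.false_of_three_lines {Z : Finset (ℙ ℂ (Fin 3 → ℂ))}
    {F : MvPolynomial (Fin 3) ℂ} {d m : ℕ} (hF : IsSmallForm Z F d m)
    {L : MvPolynomial (Fin 3) ℂ} (hL : IsLine L) {N : Finset (ℙ ℂ (Fin 3 → ℂ))}
    (hN : ∀ P ∈ N, P ∈ Z ∧ OnCurve L P) {l : Fin 3 → MvPolynomial (Fin 3) ℂ}
    {S : Fin 3 → Finset (ℙ ℂ (Fin 3 → ℂ))} {h : Fin 3 → ℕ} (hl : ∀ i, IsLine (l i))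
    (hS : ∀ i, ∀ P ∈ S i, P ∈ Z ∧ ¬ OnCurve L P ∧ OnCurve (l i) P)
    (hne : ∀ i, (S i).Nonempty) (hcard : ∑ i, (S i).card = 6)
    (hk : ∀ i, ∑ j, ∑ P ∈ S j, ordAt P (l i) ≤ 3 + h i) (h1 : ∀ i, h i ≤ 1)
    (hNcard : ∑ i, h i + 4 ≤ N.card) : False := by
  classical
  have hone : ∀ i, (N.filter (OnCurve (l i))).card ≤ 1 := by
    intro i
    obtain ⟨R, hR⟩ := hne i
    exact card_inter_le_one hL (hl i) (hS i R hR).2.2 (hS i R hR).2.1 fun P hP => (hN P hP).2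
  let D := Finset.univ.biUnion fun i => if h i = 0 then ∅ else N.filter (OnCurve (l i))
  have hD : D.card ≤ ∑ i, h i := by
    refine Finset.card_biUnion_le.trans (Finset.sum_le_sum fun i _ => ?_)
    split_ifs with hi
    · simp
    · have := hone i
      omega
  have hsub : 4 ≤ (N \ D).card := by
    have := Finset.le_card_sdiff D N
    omega
  obtain ⟨T, hTN, hT⟩ := Finset.exists_subset_card_eq hsub
  have hTN' : ∀ P ∈ T, P ∈ N := fun P hP => (Finset.mem_sdiff.mp (hTN hP)).1
  have hTl : ∀ i, (T.filter (OnCurve (l i))).card + h i ≤ 1 := by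
    intro i
    by_cases hi : h i = 0
    · have := Finset.card_le_card (Finset.filter_subset_filter (OnCurve (l i)) hTN')
      have := hone i
      omega
    · have : T.filter (OnCurve (l i)) = ∅ := by
        rw [Finset.filter_eq_empty_iff]
        intro P hP hPl
        refine (Finset.mem_sdiff.mp (hTN hP)).2 (Finset.mem_biUnion.mpr ⟨i, Finset.mem_univ _, ?_⟩)
        rw [if_neg hi]
        exact Finset.mem_filter.mpr ⟨hTN' P hP, hPl⟩
      rw [this]
      have := h1 i
      simpa using this
  refine hF.false_of_testCurves (ι := Option (Fin 3)) (C := fun o => o.elim L l) (e := fun _ => 1)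
    (S := fun o => o.elim T S) ?_ ?_ (by simp) ?_ ?_
  · rintro (_ | i)
    · exact isTestCurve_of_isLine hL
    · exact isTestCurve_of_isLine (hl i)
  · rintro (_ | i) P hP
    · exact hN P (hTN' P hP)
    · exact ⟨(hS i P hP).1, (hS i P hP).2.2⟩
  · rw [Fintype.sum_option]
    simp [hT, hcard]
  · rintro (_ | i) <;> rw [Fintype.sum_option]
    · have h2 : ∑ j, ∑ P ∈ S j, ordAt P L = 0 :=
        Finset.sum_eq_zero fun j _ => Finset.sum_eq_zero fun P hP =>
          ordAt_eq_zero (hS j P hP).2.1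
      have h3 : ∑ P ∈ T, ordAt P L ≤ T.card := by
        simpa using Finset.sum_le_card_nsmul T _ 1 fun P _ => ordAt_le_one_of_isLine hL P
      simp only [Option.elim]
      omega
    · have h2 := hk i
      have h3 := hTl i
      have h4 := sum_ordAt_le_card (T := T) fun P _ => ordAt_le_one_of_isLine (hl i) P
      simp only [Option.elim]
      omega

/-- An irreducible conic with nine points of `Z`, not containing `Z`, excludes small forms. -/
theorem IsSmallForm.false_of_conic {Z : Finset (ℙ ℂ (Fin 3 → ℂ))}
    {F : MvPolynomial (Fin 3) ℂ} {d m : ℕ} (hF : IsSmallForm Z F d m)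
    {Q : MvPolynomial (Fin 3) ℂ} (hQ : Irreducible Q) (hQ2 : Q.IsHomogeneous 2)
    {S : Finset (ℙ ℂ (Fin 3 → ℂ))} (hS : ∀ P ∈ S, P ∈ Z ∧ OnCurve Q P) (hcard : S.card = 8)
    {P : ℙ ℂ (Fin 3 → ℂ)} (hP : P ∈ Z) (hPQ : ¬ OnCurve Q P) : False := by
  classical
  obtain ⟨a, ha, b, hb, hab⟩ := Finset.one_lt_card.mp (by omega : 1 < S.card)
  have hPS : ∀ x ∈ S, P ≠ x := by
    rintro x hx rfl
    exact hPQ (hS P hx).2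
  obtain ⟨L, hL, hLP, -⟩ := exists_isLine_onCurve (hPS a ha)
  have hQone : ∀ x ∈ S, ordAt x Q ≤ 1 := by
    intro x hx
    by_cases hxa : x = a
    · exact ordAt_le_one_of_conic hQ hQ2 (hxa ▸ hab) (hS b hb).2
    · exact ordAt_le_one_of_conic hQ hQ2 hxa (hS a ha).2
  have hmeet : ∑ x ∈ S, ordAt x L ≤ 2 := by
    refine (sum_ordAt_le_card fun x _ => ordAt_le_one_of_isLine hL x).trans ?_
    have h1 := (isTestCurve_of_isLine hL).bezout Q 2 hQ2 (not_isLine_dvd_conic hL hQ hQ2)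
      (S.filter (OnCurve L)) fun x hx => (Finset.mem_filter.mp hx).2
    have h2 := Finset.card_nsmul_le_sum (S.filter (OnCurve L)) (fun x => ordAt x Q) 1
      fun x hx => one_le_ordAt hQ.ne_zero (hS x (Finset.mem_filter.mp hx).1).2
    simp only [smul_eq_mul, mul_one] at h2
    omega
  have hPL := ordAt_le_one_of_isLine hL P
  have hPQ0 := ordAt_eq_zero hPQ
  have hSQ : ∑ x ∈ S, ordAt x Q ≤ 8 := by
    simpa [hcard] using Finset.sum_le_card_nsmul S _ 1 hQone
  refine hF.false_of_testCurves (ι := Option (Fin 2)) (C := fun o => o.elim Q fun _ => L)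
    (e := fun o => o.elim 2 fun _ => 1) (S := fun o => o.elim S fun _ => {P}) ?_ ?_ (by simp) ?_ ?_
  · rintro (_ | i)
    · exact isTestCurve_of_conic hQ hQ2
    · exact isTestCurve_of_isLine hL
  · rintro (_ | i) x hx
    · exact hS x hx
    · obtain rfl := Finset.mem_singleton.mp hx
      exact ⟨hP, hLP⟩
  · simp [hcard]
  · rintro (_ | i) <;> simp [Fintype.sum_option] <;> omega

theorem not_onCurve_of_common {l l' : MvPolynomial (Fin 3) ℂ} (hl : IsLine l) (hl' : IsLine l')
    {A B C : ℙ ℂ (Fin 3 → ℂ)} (hAB : A ≠ B) (hlA : OnCurve l A) (hlB : OnCurve l B)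
    (hlA' : OnCurve l' A) (hlC' : OnCurve l' C) (hlC : ¬ OnCurve l C) : ¬ OnCurve l' B :=
  fun h => hlC (onCurve_of_two_common hl' hl hAB hlA' h hlA hlB hlC')

section LineCases

variable {Z : Finset (ℙ ℂ (Fin 3 → ℂ))} {F : MvPolynomial (Fin 3) ℂ} {d m : ℕ}
  {L : MvPolynomial (Fin 3) ℂ} {N M : Finset (ℙ ℂ (Fin 3 → ℂ))}

/-- Explicit form of `IsSmallForm.false_of_three_lines`. -/
theorem IsSmallForm.false_of_lines (hF : IsSmallForm Z F d m) (hL : IsLine L)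
    (hN : ∀ P ∈ N, P ∈ Z ∧ OnCurve L P) (hM : ∀ P ∈ M, P ∈ Z ∧ ¬ OnCurve L P)
    {l₁ l₂ l₃ : MvPolynomial (Fin 3) ℂ} {S₁ S₂ S₃ : Finset (ℙ ℂ (Fin 3 → ℂ))} (h₁ h₂ h₃ : ℕ)
    (hl₁ : IsLine l₁) (hl₂ : IsLine l₂) (hl₃ : IsLine l₃)
    (hS₁ : ∀ P ∈ S₁, P ∈ M ∧ OnCurve l₁ P) (hS₂ : ∀ P ∈ S₂, P ∈ M ∧ OnCurve l₂ P)
    (hS₃ : ∀ P ∈ S₃, P ∈ M ∧ OnCurve l₃ P)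
    (hne : S₁.Nonempty ∧ S₂.Nonempty ∧ S₃.Nonempty) (hcard : S₁.card + S₂.card + S₃.card = 6)
    (hk₁ : ∑ P ∈ S₁, ordAt P l₁ + ∑ P ∈ S₂, ordAt P l₁ + ∑ P ∈ S₃, ordAt P l₁ ≤ 3 + h₁)
    (hk₂ : ∑ P ∈ S₁, ordAt P l₂ + ∑ P ∈ S₂, ordAt P l₂ + ∑ P ∈ S₃, ordAt P l₂ ≤ 3 + h₂)
    (hk₃ : ∑ P ∈ S₁, ordAt P l₃ + ∑ P ∈ S₂, ordAt P l₃ + ∑ P ∈ S₃, ordAt P l₃ ≤ 3 + h₃)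
    (hh : h₁ ≤ 1 ∧ h₂ ≤ 1 ∧ h₃ ≤ 1) (hNcard : h₁ + h₂ + h₃ + 4 ≤ N.card) : False := by
  refine hF.false_of_three_lines hL hN (l := ![l₁, l₂, l₃]) (S := ![S₁, S₂, S₃])
    (h := ![h₁, h₂, h₃]) ?_ ?_ ?_ ?_ ?_ ?_ ?_
  · simp [Fin.forall_fin_succ, hl₁, hl₂, hl₃]
  · have aux : ∀ {S : Finset (ℙ ℂ (Fin 3 → ℂ))} {l}, (∀ P ∈ S, P ∈ M ∧ OnCurve l P) →
        ∀ P ∈ S, P ∈ Z ∧ ¬ OnCurve L P ∧ OnCurve l P := fun h P hP =>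
      ⟨(hM P (h P hP).1).1, (hM P (h P hP).1).2, (h P hP).2⟩
    simpa only [Fin.forall_fin_succ] using ⟨aux hS₁, aux hS₂, aux hS₃, fun i => i.elim0⟩
  · simpa [Fin.forall_fin_succ] using hne
  · simpa [Fin.sum_univ_three] using hcard
  · simpa [Fin.forall_fin_succ, Fin.sum_univ_three] using ⟨hk₁, hk₂, hk₃⟩
  · simpa [Fin.forall_fin_succ] using hh
  · simpa [Fin.sum_univ_three] using hNcard

theorem IsSmallForm.false_of_seven (hF : IsSmallForm Z F d m) (hL : IsLine L)
    (hN : ∀ P ∈ N, P ∈ Z ∧ OnCurve L P) (hM : ∀ P ∈ M, P ∈ Z ∧ ¬ OnCurve L P)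
    (hcol : ∀ l, IsLine l → ∃ P ∈ M, ¬ OnCurve l P) (hMcard : 2 ≤ M.card)
    (hNcard : 7 ≤ N.card) : False := by
  classical
  obtain ⟨A, hA, B, hB, hAB⟩ := Finset.one_lt_card.mp hMcard
  obtain ⟨l, hl, hlA, hlB⟩ := exists_isLine_onCurve hAB
  obtain ⟨C, hC, hlC⟩ := hcol l hl
  have hAC : A ≠ C := by rintro rfl; exact hlC hlA
  have hBC : B ≠ C := by rintro rfl; exact hlC hlB
  obtain ⟨l', hl', hlA', hlC'⟩ := exists_isLine_onCurve hAC
  obtain ⟨l'', hl'', hlB'', hlC''⟩ := exists_isLine_onCurve hBC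
  have h1 : ¬ OnCurve l' B :=
    not_onCurve_of_common hl hl' hAB hlA hlB hlA' hlC' hlC
  have h2 : ¬ OnCurve l'' A :=
    not_onCurve_of_common hl hl'' hAB.symm hlB hlA hlB'' hlC'' hlC
  have o := fun (P : ℙ ℂ (Fin 3 → ℂ)) => ordAt_le_one_of_isLine hl P
  have o' := fun (P : ℙ ℂ (Fin 3 → ℂ)) => ordAt_le_one_of_isLine hl' P
  have o'' := fun (P : ℙ ℂ (Fin 3 → ℂ)) => ordAt_le_one_of_isLine hl'' P
  refine hF.false_of_lines hL hN hM (S₁ := {A, B}) (S₂ := {A, C}) (S₃ := {B, C}) 1 1 1 hl hl' hl''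
    (by simp [*]) (by simp [*]) (by simp [*]) (by simp) (by simp [*]) ?_ ?_ ?_ (by simp) (by omega)
  · rw [Finset.sum_pair hAB, Finset.sum_pair hAC, Finset.sum_pair hBC, ordAt_eq_zero hlC]
    have := o A; have := o B
    omega
  · rw [Finset.sum_pair hAB, Finset.sum_pair hAC, Finset.sum_pair hBC, ordAt_eq_zero h1]
    have := o' A; have := o' C
    omega
  · rw [Finset.sum_pair hAB, Finset.sum_pair hAC, Finset.sum_pair hBC, ordAt_eq_zero h2]
    have := o'' B; have := o'' C
    omega

/-- Three collinear points and a point off their line, next to a line with six points. -/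
theorem IsSmallForm.false_of_six_of_collinear (hF : IsSmallForm Z F d m) (hL : IsLine L)
    (hN : ∀ P ∈ N, P ∈ Z ∧ OnCurve L P) (hM : ∀ P ∈ M, P ∈ Z ∧ ¬ OnCurve L P)
    (hcol : ∀ l, IsLine l → ∃ P ∈ M, ¬ OnCurve l P) (hNcard : 6 ≤ N.card)
    {l : MvPolynomial (Fin 3) ℂ} (hl : IsLine l) {X Y T : ℙ ℂ (Fin 3 → ℂ)}
    (hX : X ∈ M) (hY : Y ∈ M) (hT : T ∈ M) (hXY : X ≠ Y) (hXT : X ≠ T) (hYT : Y ≠ T)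
    (hlX : OnCurve l X) (hlY : OnCurve l Y) (hlT : OnCurve l T) : False := by
  classical
  obtain ⟨W, hW, hlW⟩ := hcol l hl
  have hXW : X ≠ W := by rintro rfl; exact hlW hlX
  have hYW : Y ≠ W := by rintro rfl; exact hlW hlY
  obtain ⟨l', hl', hlX', hlW'⟩ := exists_isLine_onCurve hXW
  obtain ⟨l'', hl'', hlY'', hlW''⟩ := exists_isLine_onCurve hYW
  have hY' := not_onCurve_of_common hl hl' hXY hlX hlY hlX' hlW' hlW
  have hT' := not_onCurve_of_common hl hl' hXT hlX hlT hlX' hlW' hlW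
  have hX'' := not_onCurve_of_common hl hl'' hXY.symm hlY hlX hlY'' hlW'' hlW
  have hT'' := not_onCurve_of_common hl hl'' hYT hlY hlT hlY'' hlW'' hlW
  have o := fun (P : ℙ ℂ (Fin 3 → ℂ)) => ordAt_le_one_of_isLine hl P
  have o' := fun (P : ℙ ℂ (Fin 3 → ℂ)) => ordAt_le_one_of_isLine hl' P
  have o'' := fun (P : ℙ ℂ (Fin 3 → ℂ)) => ordAt_le_one_of_isLine hl'' P
  have hsum : ∀ f : ℙ ℂ (Fin 3 → ℂ) → ℕ, ∑ P ∈ {X, Y, T}, f P = f X + f Y + f T := by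
    intro f
    rw [Finset.sum_insert (by simp [*]), Finset.sum_pair hYT, add_assoc]
  refine hF.false_of_lines hL hN hM (S₁ := {X, Y, T}) (S₂ := {X, W}) (S₃ := {W}) 1 1 0 hl hl' hl''
    (by simp [*]) (by simp [*]) (by simp [*]) (by simp) (by simp [*]) ?_ ?_ ?_ (by simp) (by omega)
  · rw [hsum, Finset.sum_pair hXW, Finset.sum_singleton, ordAt_eq_zero hlW]
    have := o X; have := o Y; have := o T
    omega
  · rw [hsum, Finset.sum_pair hXW, Finset.sum_singleton, ordAt_eq_zero hY', ordAt_eq_zero hT']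
    have := o' X; have := o' W
    omega
  · rw [hsum, Finset.sum_pair hXW, Finset.sum_singleton, ordAt_eq_zero hX'', ordAt_eq_zero hT'']
    have := o'' Y; have := o'' W
    omega

/-- Points in general position, next to a line with at least five points. -/
theorem IsSmallForm.false_of_five_of_general (hF : IsSmallForm Z F d m) (hL : IsLine L)
    (hN : ∀ P ∈ N, P ∈ Z ∧ OnCurve L P) (hM : ∀ P ∈ M, P ∈ Z ∧ ¬ OnCurve L P)
    (hgen : ∀ l, IsLine l → ∀ P ∈ M, ∀ Q ∈ M, ∀ R ∈ M, P ≠ Q → P ≠ R → Q ≠ R →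
      OnCurve l P → OnCurve l Q → ¬ OnCurve l R)
    (hNcard : 5 ≤ N.card) (hMcard : 10 ≤ N.card + M.card) (hM4 : 4 ≤ M.card) : False := by
  classical
  obtain ⟨M', hM'M, hM'⟩ := Finset.exists_subset_card_eq hM4
  obtain ⟨A, B, C, D, hAB, hAC, hAD, hBC, hBD, hCD, rfl⟩ := Finset.card_eq_four.mp hM'
  simp only [Finset.insert_subset_iff, Finset.singleton_subset_iff] at hM'M
  obtain ⟨hA, hB, hC, hD⟩ := hM'M
  obtain ⟨E, h, hE, hh, hAE, hBE, hCE, hDE, hNh⟩ : ∃ E h, E ∈ M ∧ h ≤ 1 ∧ A ≠ E ∧ B ≠ E ∧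
      (C = E → h = 1) ∧ D ≠ E ∧ h + 4 ≤ N.card := by
    by_cases h6 : 6 ≤ N.card
    · exact ⟨C, 1, hC, le_rfl, hAC, hBC, fun _ => rfl, hCD.symm, by omega⟩
    · obtain ⟨E, hE, hE'⟩ : ∃ E ∈ M, E ∉ ({A, B, C, D} : Finset (ℙ ℂ (Fin 3 → ℂ))) :=
        Finset.exists_mem_notMem_of_card_lt_card (by omega)
      simp only [Finset.mem_insert, Finset.mem_singleton, not_or] at hE'
      obtain ⟨h1, h2, h3, h4⟩ := hE'
      exact ⟨E, 0, hE, zero_le_one, Ne.symm h1, Ne.symm h2, fun h => absurd h.symm h3, Ne.symm h4,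
        by omega⟩
  obtain ⟨l, hl, hlA, hlB⟩ := exists_isLine_onCurve hAB
  obtain ⟨l', hl', hlC', hlD'⟩ := exists_isLine_onCurve hCD
  obtain ⟨l'', hl'', hlA'', hlE''⟩ := exists_isLine_onCurve hAE
  have o := fun (P : ℙ ℂ (Fin 3 → ℂ)) => ordAt_le_one_of_isLine hl P
  have o' := fun (P : ℙ ℂ (Fin 3 → ℂ)) => ordAt_le_one_of_isLine hl' P
  have o'' := fun (P : ℙ ℂ (Fin 3 → ℂ)) => ordAt_le_one_of_isLine hl'' P
  have hC1 := hgen l hl A hA B hB C hC hAB hAC hBC hlA hlB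
  have hD1 := hgen l hl A hA B hB D hD hAB hAD hBD hlA hlB
  have hE1 := hgen l hl A hA B hB E hE hAB hAE hBE hlA hlB
  have hA2 := hgen l' hl' C hC D hD A hA hCD hAC.symm hAD.symm hlC' hlD'
  have hB2 := hgen l' hl' C hC D hD B hB hCD hBC.symm hBD.symm hlC' hlD'
  have hB3 := hgen l'' hl'' A hA E hE B hB hAE hAB hBE.symm hlA'' hlE''
  have hD3 := hgen l'' hl'' A hA E hE D hD hAE hAD hDE.symm hlA'' hlE''
  have hC3 : ordAt C l'' ≤ h := by
    by_cases hCE' : C = E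
    · rw [hCE hCE']
      exact o'' C
    · rw [ordAt_eq_zero (hgen l'' hl'' A hA E hE C hC hAE hAC (Ne.symm hCE') hlA'' hlE'')]
      exact Nat.zero_le _
  refine hF.false_of_lines hL hN hM (S₁ := {A, B}) (S₂ := {C, D}) (S₃ := {A, E}) 0 0 h hl hl' hl''
    (by simp [hA, hB, hlA, hlB]) (by simp [hC, hD, hlC', hlD']) (by simp [hA, hE, hlA'', hlE''])
    (by simp) (by rw [Finset.card_pair hAB, Finset.card_pair hCD, Finset.card_pair hAE]) ?_ ?_ ?_
    ⟨zero_le_one, zero_le_one, hh⟩ (by omega)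
  · rw [Finset.sum_pair hAB, Finset.sum_pair hCD, Finset.sum_pair hAE, ordAt_eq_zero hC1,
      ordAt_eq_zero hD1, ordAt_eq_zero hE1]
    have := o A; have := o B
    omega
  · rw [Finset.sum_pair hAB, Finset.sum_pair hCD, Finset.sum_pair hAE, ordAt_eq_zero hA2,
      ordAt_eq_zero hB2]
    have := o' C; have := o' D; have := o' E
    omega
  · rw [Finset.sum_pair hAB, Finset.sum_pair hCD, Finset.sum_pair hAE, ordAt_eq_zero hB3,
      ordAt_eq_zero hD3]
    have := o'' A; have := o'' E
    omega

/-- Four collinear points and a point off their line, next to a line with five points. -/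
theorem IsSmallForm.false_of_five_of_four (hF : IsSmallForm Z F d m) (hL : IsLine L)
    (hN : ∀ P ∈ N, P ∈ Z ∧ OnCurve L P) (hM : ∀ P ∈ M, P ∈ Z ∧ ¬ OnCurve L P)
    (hcol : ∀ l, IsLine l → ∃ P ∈ M, ¬ OnCurve l P) (hNcard : 5 ≤ N.card)
    {l : MvPolynomial (Fin 3) ℂ} (hl : IsLine l) {S : Finset (ℙ ℂ (Fin 3 → ℂ))}
    (hS : ∀ P ∈ S, P ∈ M ∧ OnCurve l P) (hScard : S.card = 4) : False := by
  classical
  obtain ⟨W, hW, hlW⟩ := hcol l hl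
  obtain ⟨X, hX⟩ := Finset.card_pos.mp (by omega : 0 < S.card)
  obtain ⟨hXM, hlX⟩ := hS X hX
  have hXW : X ≠ W := by rintro rfl; exact hlW hlX
  obtain ⟨l', hl', hlX', hlW'⟩ := exists_isLine_onCurve hXW
  have h1 := sum_ordAt_le_card (T := S) fun P _ => ordAt_le_one_of_isLine hl' P
  have h2 := card_inter_le_one hl hl' hlW' hlW fun P hP => (hS P hP).2
  have h3 := ordAt_le_one_of_isLine hl' W
  have h4 : ∑ P ∈ S, ordAt P l ≤ 4 := by
    simpa [hScard] using Finset.sum_le_card_nsmul S _ 1 fun P _ => ordAt_le_one_of_isLine hl P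
  refine hF.false_of_lines hL hN hM (S₁ := S) (S₂ := {W}) (S₃ := {W}) 1 0 0 hl hl' hl'
    hS (by simp [*]) (by simp [*]) ⟨⟨X, hX⟩, by simp⟩ (by simp [*]) ?_ ?_ ?_ (by simp) (by omega)
  · simpa [ordAt_eq_zero hlW] using h4
  all_goals simp only [Finset.sum_singleton]; omega

/-- Three collinear points and two points off their line, next to a line with five points. -/
theorem IsSmallForm.false_of_five_of_three (hF : IsSmallForm Z F d m) (hL : IsLine L)
    (hN : ∀ P ∈ N, P ∈ Z ∧ OnCurve L P) (hM : ∀ P ∈ M, P ∈ Z ∧ ¬ OnCurve L P)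
    (hNcard : 5 ≤ N.card)
    {l : MvPolynomial (Fin 3) ℂ} (hl : IsLine l) {S : Finset (ℙ ℂ (Fin 3 → ℂ))}
    (hS : ∀ P ∈ S, P ∈ M ∧ OnCurve l P) (hScard : S.card = 3) {U W : ℙ ℂ (Fin 3 → ℂ)}
    (hU : U ∈ M) (hW : W ∈ M) (hUW : U ≠ W) (hlU : ¬ OnCurve l U) (hlW : ¬ OnCurve l W) :
    False := by
  classical
  obtain ⟨l', hl', hlU', hlW'⟩ := exists_isLine_onCurve hUW
  have h2 := card_inter_le_one hl hl' hlU' hlU fun P hP => (hS P hP).2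
  obtain ⟨X, hX, hXl'⟩ : ∃ X ∈ S, X ∉ S.filter (OnCurve l') :=
    Finset.exists_mem_notMem_of_card_lt_card (by omega)
  obtain ⟨hXM, hlX⟩ := hS X hX
  have hX' : ¬ OnCurve l' X := fun h => hXl' (Finset.mem_filter.mpr ⟨hX, h⟩)
  have hUX : U ≠ X := by rintro rfl; exact hlU hlX
  obtain ⟨l'', hl'', hlU'', hlX''⟩ := exists_isLine_onCurve hUX
  have hW'' := not_onCurve_of_common hl' hl'' hUW hlU' hlW' hlU'' hlX'' hX'
  have h1 := sum_ordAt_le_card (T := S) fun P _ => ordAt_le_one_of_isLine hl' P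
  have h3 := sum_ordAt_le_card (T := S) fun P _ => ordAt_le_one_of_isLine hl'' P
  have h4 := card_inter_le_one hl hl'' hlU'' hlU fun P hP => (hS P hP).2
  have h5 : ∑ P ∈ S, ordAt P l ≤ 3 := by
    simpa [hScard] using Finset.sum_le_card_nsmul S _ 1 fun P _ => ordAt_le_one_of_isLine hl P
  have o' := fun (P : ℙ ℂ (Fin 3 → ℂ)) => ordAt_le_one_of_isLine hl' P
  have o'' := fun (P : ℙ ℂ (Fin 3 → ℂ)) => ordAt_le_one_of_isLine hl'' P
  refine hF.false_of_lines hL hN hM (S₁ := S) (S₂ := {U, W}) (S₃ := {U}) 0 1 0 hl hl' hl''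
    hS (by simp [*]) (by simp [*]) ⟨⟨X, hX⟩, by simp⟩ (by simp [*]) ?_ ?_ ?_ (by simp) (by omega)
  · simpa [Finset.sum_pair hUW, ordAt_eq_zero hlW, ordAt_eq_zero hlU] using h5
  · rw [Finset.sum_pair hUW, Finset.sum_singleton]
    have := o' U; have := o' W
    omega
  · rw [Finset.sum_pair hUW, Finset.sum_singleton, ordAt_eq_zero hW'']
    have := o'' U
    omega

/-- A line with five points of `Z` excludes small forms unless `Z` lies on a conic. -/
theorem IsSmallForm.false_of_line (hF : IsSmallForm Z F d m) (hZ : 10 ≤ Z.card)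
    (hconic : ∀ Q : MvPolynomial (Fin 3) ℂ, Q ≠ 0 → Q.IsHomogeneous 2 → ∃ P ∈ Z, ¬ OnCurve Q P)
    (hL : IsLine L) (hN : ∀ P ∈ N, P ∈ Z ∧ OnCurve L P) (hNcard : 5 ≤ N.card) : False := by
  classical
  obtain ⟨N, hN, hNcard, M, hM, hMN, hcol⟩ : ∃ N : Finset (ℙ ℂ (Fin 3 → ℂ)),
      (∀ P ∈ N, P ∈ Z ∧ OnCurve L P) ∧ 5 ≤ N.card ∧ ∃ M : Finset (ℙ ℂ (Fin 3 → ℂ)),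
      (∀ P ∈ M, P ∈ Z ∧ ¬ OnCurve L P) ∧ 10 ≤ N.card + M.card ∧
      ∀ l, IsLine l → ∃ P ∈ M, ¬ OnCurve l P := by
    refine ⟨Z.filter (OnCurve L), fun P hP => Finset.mem_filter.mp hP, hNcard.trans
      (Finset.card_le_card fun P hP => Finset.mem_filter.mpr (hN P hP)),
      Z.filter fun P => ¬ OnCurve L P, fun P hP => Finset.mem_filter.mp hP, ?_, fun l hl => ?_⟩
    · rwa [Finset.card_filter_add_card_filter_not]
    · obtain ⟨P, hP, hPLl⟩ := hconic (L * l) (mul_ne_zero hL.1 hl.1) (hL.2.mul hl.2)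
      rw [OnCurve, map_mul, mul_eq_zero, not_or] at hPLl
      exact ⟨P, Finset.mem_filter.mpr ⟨hP, hPLl.1⟩, hPLl.2⟩
  have hMcard : 2 ≤ M.card := by
    by_contra! h
    obtain ⟨P, hP⟩ : M.Nonempty := by
      obtain ⟨P, hP, -⟩ := hcol L hL
      exact ⟨P, hP⟩
    obtain ⟨Q, hQ⟩ := Finset.card_pos.mp (by omega : 0 < N.card)
    have hPQ : P ≠ Q := by rintro rfl; exact (hM P hP).2 (hN P hQ).2
    obtain ⟨l, hl, hlP, -⟩ := exists_isLine_onCurve hPQ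
    obtain ⟨R, hR, hlR⟩ := hcol l hl
    exact hlR (Finset.card_le_one.mp (by omega) P hP R hR ▸ hlP)
  by_cases h7 : 7 ≤ N.card
  · exact hF.false_of_seven hL hN hM hcol hMcard h7
  by_cases hgen : ∀ l, IsLine l → (M.filter (OnCurve l)).card ≤ 2
  · refine hF.false_of_five_of_general hL hN hM (fun l hl P hP Q hQ R hR hPQ hPR hQR hlP hlQ hlR =>
      ?_) hNcard hMN (by omega)
    have hsub : {P, Q, R} ⊆ M.filter (OnCurve l) := by
      simp [Finset.insert_subset_iff, *]
    have := Finset.card_le_card hsub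
    rw [Finset.card_eq_three.mpr ⟨P, Q, R, hPQ, hPR, hQR, rfl⟩] at this
    have := hgen l hl
    omega
  push Not at hgen
  obtain ⟨l, hl, h3⟩ := hgen
  by_cases h4 : 4 ≤ (M.filter (OnCurve l)).card
  · obtain ⟨S, hS, hScard⟩ := Finset.exists_subset_card_eq h4
    exact hF.false_of_five_of_four hL hN hM hcol hNcard hl
      (fun P hP => Finset.mem_filter.mp (hS hP)) hScard
  by_cases h6 : 6 ≤ N.card
  · obtain ⟨X, Y, T, hX, hY, hT, hXY, hXT, hYT⟩ := Finset.two_lt_card_iff.mp h3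
    rw [Finset.mem_filter] at hX hY hT
    exact hF.false_of_six_of_collinear hL hN hM hcol h6 hl hX.1 hY.1 hT.1 hXY hXT hYT hX.2 hY.2 hT.2
  · have := Finset.card_filter_add_card_filter_not (s := M) (OnCurve l)
    obtain ⟨U, hU, W, hW, hUW⟩ := Finset.one_lt_card.mp
      (by omega : 1 < (M.filter fun P => ¬ OnCurve l P).card)
    rw [Finset.mem_filter] at hU hW
    exact hF.false_of_five_of_three hL hN hM hNcard hl (fun P hP => Finset.mem_filter.mp hP)
      (by omega) hU.1 hW.1 hUW hU.2 hW.2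

end LineCases

open MvPolynomial in
/-- There is a conic through any five points. -/
theorem exists_conic_of_card_le_five (A : Finset (ℙ ℂ (Fin 3 → ℂ))) (hA : A.card ≤ 5) :
    ∃ Q : MvPolynomial (Fin 3) ℂ, Q ≠ 0 ∧ Q.IsHomogeneous 2 ∧ ∀ P ∈ A, OnCurve Q P := by
  let q : (Fin 6 → ℂ) →ₗ[ℂ] MvPolynomial (Fin 3) ℂ := Fintype.linearCombination ℂ
    ![X 0 * X 0, X 1 * X 1, X 2 * X 2, X 0 * X 1, X 0 * X 2, X 1 * X 2]
  let φ : (Fin 6 → ℂ) →ₗ[ℂ] (A → ℂ) :=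
    LinearMap.pi fun P => (aeval (P : ℙ ℂ (Fin 3 → ℂ)).rep).toLinearMap ∘ₗ q
  have hφ : LinearMap.ker φ ≠ ⊥ := LinearMap.ker_ne_bot_of_finrank_lt (by simp; omega)
  obtain ⟨c, hc, hc0⟩ := Submodule.exists_mem_ne_zero_of_ne_bot hφ
  have hq : q c = c 0 • (X 0 * X 0) + c 1 • (X 1 * X 1) + c 2 • (X 2 * X 2) + c 3 • (X 0 * X 1)
      + c 4 • (X 0 * X 2) + c 5 • (X 1 * X 2) := by
    simp [q, Fintype.linearCombination_apply, Fin.sum_univ_six]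
  refine ⟨q c, fun h0 => hc0 ?_, ?_, fun P hP => ?_⟩
  · have hev : ∀ x y z : ℂ, c 0 * (x * x) + c 1 * (y * y) + c 2 * (z * z) + c 3 * (x * y)
        + c 4 * (x * z) + c 5 * (y * z) = 0 := by
      intro x y z
      have := congrArg (eval ![x, y, z]) (hq.symm.trans h0)
      simpa [smul_eval] using this
    have h1 := hev 1 0 0
    have h2 := hev 0 1 0
    have h3 := hev 0 0 1
    have h4 := hev 1 1 0
    have h5 := hev 1 0 1
    have h6 := hev 0 1 1
    simp only [mul_one, mul_zero, add_zero, zero_add] at h1 h2 h3 h4 h5 h6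
    rw [h1, h2, zero_add, zero_add] at h4
    rw [h1, h3, zero_add, zero_add] at h5
    rw [h2, h3, zero_add, zero_add] at h6
    funext i
    fin_cases i <;> assumption
  · have hX : ∀ (a : ℂ) (i j : Fin 3), (a • (X i * X j) : MvPolynomial (Fin 3) ℂ).IsHomogeneous 2 :=
      fun a i j => (homogeneousSubmodule (Fin 3) ℂ 2).smul_mem a
        ((isHomogeneous_X ℂ i).mul (isHomogeneous_X ℂ j))
    rw [hq]
    exact (((((hX _ _ _).add (hX _ _ _)).add (hX _ _ _)).add (hX _ _ _)).add (hX _ _ _)).add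
      (hX _ _ _)
  · simpa [φ, OnCurve, coe_aeval_eq_eval] using congrFun (LinearMap.mem_ker.mp hc) ⟨P, hP⟩

theorem isLine_mul_isLine_of_not_irreducible {Q : MvPolynomial (Fin 3) ℂ} (hQ0 : Q ≠ 0)
    (hQ2 : Q.IsHomogeneous 2) (hQ : ¬ Irreducible Q) :
    ∃ l l' : MvPolynomial (Fin 3) ℂ, IsLine l ∧ IsLine l' ∧ Q = l * l' := by
  have hunit : ∀ {G : MvPolynomial (Fin 3) ℂ}, G ≠ 0 → G.IsHomogeneous 0 → IsUnit G := by
    intro G hG0 hG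
    have hdeg := hG.totalDegree hG0
    have hconst := MvPolynomial.totalDegree_eq_zero_iff_eq_C.mp hdeg
    refine MvPolynomial.isUnit_iff_totalDegree_of_isReduced.mpr
      ⟨isUnit_iff_ne_zero.mpr fun h => hG0 ?_, hdeg⟩
    rw [hconst, h, map_zero]
  have hnu : ¬ IsUnit Q := by
    intro h
    have := MvPolynomial.isUnit_iff_totalDegree_of_isReduced.mp h
    rw [hQ2.totalDegree hQ0] at this
    omega
  rw [irreducible_iff] at hQ
  push Not at hQ
  obtain ⟨G, H, rfl, hG, hH⟩ := hQ hnu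
  obtain ⟨a, b, hab, ha, hb⟩ := exists_isHomogeneous_of_mul hQ2 hQ0
  have hG0 := left_ne_zero_of_mul hQ0
  have hH0 := right_ne_zero_of_mul hQ0
  have ha0 : a ≠ 0 := by rintro rfl; exact hG (hunit hG0 ha)
  have hb0 : b ≠ 0 := by rintro rfl; exact hH (hunit hH0 hb)
  obtain rfl : a = 1 := by omega
  obtain rfl : b = 1 := by omega
  exact ⟨G, H, ⟨hG0, ha⟩, ⟨hH0, hb⟩, rfl⟩

open Classical in
/-- Five points of `Z` lie on test curves of total degree two meeting `Z` in few points. -/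
theorem exists_testCurves_of_card_eq_five {Z A : Finset (ℙ ℂ (Fin 3 → ℂ))}
    (hline : ∀ l, IsLine l → (Z.filter (OnCurve l)).card ≤ 4)
    (hconic : ∀ Q : MvPolynomial (Fin 3) ℂ, Irreducible Q → Q.IsHomogeneous 2 →
      (Z.filter (OnCurve Q)).card ≤ 8) (hA : A ⊆ Z) (hcard : A.card = 5) :
    ∃ (n : ℕ) (C : Fin n → MvPolynomial (Fin 3) ℂ) (e : Fin n → ℕ)
      (S : Fin n → Finset (ℙ ℂ (Fin 3 → ℂ))), (∀ i, IsTestCurve (C i) (e i)) ∧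
      (∀ i, ∀ P ∈ S i, P ∈ Z ∧ OnCurve (C i) P) ∧ ∑ i, e i = 2 ∧
      (∀ f : ℙ ℂ (Fin 3 → ℂ) → ℕ, ∑ i, ∑ P ∈ S i, f P = ∑ P ∈ A, f P) ∧
      ∀ i, ∑ P ∈ Z, ordAt P (C i) ≤ 4 * e i := by
  obtain ⟨Q, hQ0, hQ2, hQA⟩ := exists_conic_of_card_le_five A hcard.le
  by_cases hQ : Irreducible Q
  · refine ⟨1, fun _ => Q, fun _ => 2, fun _ => A, fun _ => isTestCurve_of_conic hQ hQ2,
      fun _ P hP => ⟨hA hP, hQA P hP⟩, by simp, by simp, fun _ => ?_⟩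
    refine (sum_ordAt_le_card fun P _ => ?_).trans (hconic Q hQ hQ2)
    obtain ⟨P', hP', hne⟩ := Finset.exists_mem_ne (by omega : 1 < A.card) P
    exact ordAt_le_one_of_conic hQ hQ2 hne.symm (hQA P' hP')
  · obtain ⟨l, l', hl, hl', rfl⟩ := isLine_mul_isLine_of_not_irreducible hQ0 hQ2 hQ
    have aux : ∀ {l}, IsLine l → ∑ P ∈ Z, ordAt P l ≤ 4 := fun h =>
      (sum_ordAt_le_card fun P _ => ordAt_le_one_of_isLine h P).trans (hline _ h)
    refine ⟨2, ![l, l'], fun _ => 1,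
      ![A.filter (OnCurve l), A.filter fun P => ¬ OnCurve l P], ?_, ?_, by simp, ?_, ?_⟩
    · simp [Fin.forall_fin_two, isTestCurve_of_isLine, hl, hl']
    · simp only [Fin.forall_fin_two, Matrix.cons_val_zero, Matrix.cons_val_one, Finset.mem_filter]
      refine ⟨fun P hP => ⟨hA hP.1, hP.2⟩, fun P hP => ⟨hA hP.1, ?_⟩⟩
      have := hQA P hP.1
      rw [OnCurve, map_mul, mul_eq_zero] at this
      exact this.resolve_left hP.2
    · intro f
      simpa [Fin.sum_univ_two] using Finset.sum_filter_add_sum_filter_not A (OnCurve l) f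
    · simp [Fin.forall_fin_two, aux, hl, hl']

/-- Forms of small degree only exist for point sets on conics. -/
theorem IsSmallForm.exists_conic {Z : Finset (ℙ ℂ (Fin 3 → ℂ))}
    {F : MvPolynomial (Fin 3) ℂ} {d m : ℕ} (hF : IsSmallForm Z F d m) (hZ : 10 ≤ Z.card) :
    ∃ Q : MvPolynomial (Fin 3) ℂ, Q ≠ 0 ∧ Q.IsHomogeneous 2 ∧ ∀ P ∈ Z, OnCurve Q P := by
  classical
  by_contra! hcon
  have hline : ∀ l, IsLine l → (Z.filter (OnCurve l)).card ≤ 4 := by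
    intro l hl
    by_contra! h
    exact hF.false_of_line hZ hcon hl (fun P hP => Finset.mem_filter.mp hP) h
  have hconic : ∀ Q : MvPolynomial (Fin 3) ℂ, Irreducible Q → Q.IsHomogeneous 2 →
      (Z.filter (OnCurve Q)).card ≤ 8 := by
    intro Q hQ hQ2
    by_contra! h
    obtain ⟨S, hS, hScard⟩ := Finset.exists_subset_card_eq h.le
    obtain ⟨P, hP, hPQ⟩ := hcon Q hQ.ne_zero hQ2
    exact hF.false_of_conic hQ hQ2 (fun P hP => Finset.mem_filter.mp (hS hP)) hScard hP hPQ
  obtain ⟨A, hA, hAcard⟩ := Finset.exists_subset_card_eq (by omega : 5 ≤ Z.card)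
  obtain ⟨B, hB, hBcard⟩ := Finset.exists_subset_card_eq
    (by rw [Finset.card_sdiff_of_subset hA]; omega : 5 ≤ (Z \ A).card)
  have hBZ : B ⊆ Z := hB.trans Finset.sdiff_subset
  have hdisj : Disjoint A B := Finset.disjoint_of_subset_right hB Finset.disjoint_sdiff
  obtain ⟨n, C, e, S, hC, hS, he, hsum, hcap⟩ :=
    exists_testCurves_of_card_eq_five hline hconic hA hAcard
  obtain ⟨n', C', e', S', hC', hS', he', hsum', hcap'⟩ :=
    exists_testCurves_of_card_eq_five hline hconic hBZ hBcard
  have hle : ∀ f : ℙ ℂ (Fin 3 → ℂ) → ℕ, ∑ P ∈ A, f P + ∑ P ∈ B, f P ≤ ∑ P ∈ Z, f P := by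
    intro f
    rw [← Finset.sum_union hdisj]
    exact Finset.sum_le_sum_of_subset (Finset.union_subset hA hBZ)
  refine hF.false_of_testCurves (ι := Fin n ⊕ Fin n') (C := Sum.elim C C') (e := Sum.elim e e')
    (S := Sum.elim S S') ?_ ?_ ?_ ?_ ?_
  · rintro (i | i)
    exacts [hC i, hC' i]
  · rintro (i | i)
    exacts [hS i, hS' i]
  · simp [he, he']
  · have h1 := hsum fun _ => 1
    have h2 := hsum' fun _ => 1
    simp only [Finset.sum_const, smul_eq_mul, mul_one] at h1 h2
    simp [h1, h2, hAcard, hBcard]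
  · rintro (i | i) <;> simp only [Fintype.sum_sum_type, Sum.elim_inl, Sum.elim_inr, hsum, hsum']
    exacts [(hle _).trans (hcap i), (hle _).trans (hcap' i)]

theorem eval_eq_zero_of_onCurve {F : MvPolynomial (Fin 3) ℂ} {d : ℕ} (hF : F.IsHomogeneous d)
    {P : ℙ ℂ (Fin 3 → ℂ)} (hP : OnCurve F P) {v : Fin 3 → ℂ} {hv : v ≠ 0}
    (h : Projectivization.mk ℂ v hv = P) : MvPolynomial.eval v F = 0 := by
  rw [← P.mk_rep, Projectivization.mk_eq_mk_iff'] at h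
  obtain ⟨a, rfl⟩ := h
  rw [eval_smul_of_isHomogeneous hF, show MvPolynomial.eval P.rep F = 0 from hP, mul_zero]

theorem pow_mem_symbolicPower {Z : Set (ℙ ℂ (Fin 3 → ℂ))} {G : MvPolynomial (Fin 3) ℂ} {d : ℕ}
    (hG : G.IsHomogeneous d) (hGZ : ∀ P ∈ Z, OnCurve G P) (m : ℕ) :
    G ^ m ∈ symbolicPower Z m := fun P hP v _ hvP => by
  simpa using vanishesToOrder_pow_mul (eval_eq_zero_of_onCurve hG (hGZ P hP) hvP) m 1

/-- Some form vanishes on a given finite set of points. -/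
theorem exists_form_onCurve (Z : Finset (ℙ ℂ (Fin 3 → ℂ))) (hZ : 1 < Z.card) :
    ∃ (G : MvPolynomial (Fin 3) ℂ) (d : ℕ), G ≠ 0 ∧ G.IsHomogeneous d ∧ ∀ P ∈ Z, OnCurve G P := by
  have hex : ∀ P : ℙ ℂ (Fin 3 → ℂ), ∃ l, IsLine l ∧ OnCurve l P := fun P => by
    obtain ⟨P', -, hne⟩ := Finset.exists_mem_ne hZ P
    obtain ⟨l, hl, hlP, -⟩ := exists_isLine_onCurve hne.symm
    exact ⟨l, hl, hlP⟩
  choose l hl hlP using hex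
  refine ⟨∏ P ∈ Z, l P, ∑ _P ∈ Z, 1, Finset.prod_ne_zero_iff.mpr fun P _ => (hl P).1,
    MvPolynomial.IsHomogeneous.prod _ _ _ fun P _ => (hl P).2, fun P hP => ?_⟩
  rw [OnCurve, map_prod]
  exact Finset.prod_eq_zero hP (hlP P)

/-- A set of `s ≥ 10` points of `ℙ²` with Waldschmidt constant less than `5/2` is contained in
a conic, and consequently has Waldschmidt constant at most `2`. -/
theorem ten_points_small_waldschmidt (Z : Set (ℙ ℂ (Fin 3 → ℂ)))
    (hfin : Z.Finite) (hcard : 10 ≤ Z.ncard) (h : waldschmidt Z < 5 / 2) :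
    ContainedInConic Z ∧ waldschmidt Z ≤ 2 := by
  lift Z to Finset (ℙ ℂ (Fin 3 → ℂ)) using hfin
  rw [Set.ncard_coe_finset] at hcard
  obtain ⟨m, hm⟩ := exists_lt_of_ciInf_lt h
  have hm0 : (0 : ℝ) < (m : ℕ) := by exact_mod_cast m.pos
  obtain ⟨F, hFm, hF0, hF⟩ : initialDegree (symbolicPower Z m) ∈
      {t | ∃ F ∈ symbolicPower Z m, F ≠ 0 ∧ F.IsHomogeneous t} := by
    obtain ⟨G, e, hG0, hG, hGZ⟩ := exists_form_onCurve Z (by omega)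
    exact Nat.sInf_mem ⟨e * m, G ^ (m : ℕ), pow_mem_symbolicPower hG hGZ m, pow_ne_zero _ hG0,
      hG.pow m⟩
  have hsmall : IsSmallForm Z F (initialDegree (symbolicPower Z m)) m := by
    refine ⟨hF0, hF, fun P hP => le_ordAt hF0 (hFm P hP P.rep P.rep_nonzero P.mk_rep), ?_⟩
    rw [div_lt_iff₀ hm0] at hm
    have : (2 : ℝ) * initialDegree (symbolicPower Z m) < 5 * (m : ℕ) := by linarith
    exact_mod_cast this
  obtain ⟨Q, hQ0, hQ2, hQZ⟩ := hsmall.exists_conic hcard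
  refine ⟨⟨Q, hQ0, hQ2, fun P hP v _ hvP => eval_eq_zero_of_onCurve hQ2 (hQZ P hP) hvP⟩, ?_⟩
  have hbdd : BddBelow (Set.range fun n : ℕ+ =>
      (initialDegree (symbolicPower (Z : Set (ℙ ℂ (Fin 3 → ℂ))) n) : ℝ) / ((n : ℕ) : ℝ)) :=
    ⟨0, by rintro _ ⟨n, rfl⟩; positivity⟩
  refine (ciInf_le hbdd 1).trans ?_
  have hle : initialDegree (symbolicPower (Z : Set (ℙ ℂ (Fin 3 → ℂ))) 1) ≤ 2 :=
    Nat.sInf_le ⟨Q, by simpa using pow_mem_symbolicPower hQ2 hQZ 1, hQ0, hQ2⟩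
  simpa using hle
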